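/- arXiv:math/0001022 — 2 statements merged into one kernel-verified Lean document; each statement's English description precedes it below -/
import Mathlib

section
/- Fix real numbers t and β with 0 < t < 1, β > 0 and 0 < βt < 1. For every d > 0 there exist constants C₀, c₀ > 0 such that for all positive integers N and all integers l ≥ 0: p(N, μ₊(N), ν₊(N), l) - C₀ N^{-d} ≤ φ(N, l, t, β) ≤ p(N, μ₋(N), ν₋(N), l) + C₀ N^{-d}, where μ±(N) = ⌊t²N²/(2(1-t²)) ± c₀ N √(log N)⌋ and ν±(N) = ⌊βtN/(1-βt) ± c₀ √(N log N)⌋ (with μ₋(N), ν₋(N) replaced by 0 if negative). -/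
open scoped Classical

noncomputable section

/-- Semistandard Young tableaux of shape `μ` with entries in `{1, …, N}`. -/
def SSYTN (N : ℕ) (μ : YoungDiagram) : Type :=
  {T : SemistandardYoungTableau μ // ∀ i j : ℕ, (i, j) ∈ μ → T i j ∈ Finset.Icc 1 N}

/-- `d_λ(N)`: the number of semistandard Young tableaux of shape `μ`
with entries in `{1, …, N}`. -/
def dCount (N : ℕ) (μ : YoungDiagram) : ℕ := Nat.card (SSYTN N μ)

/-- `f(λ')`: the number of odd columns of `μ`. -/
def oddCols (μ : YoungDiagram) : ℕ :=
  ((Finset.range μ.card).filter fun j => Odd (μ.colLen j)).card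

/-- `ℓ(λ)`: the number of rows of `μ` (the length of its first column). -/
def numRows (μ : YoungDiagram) : ℕ := μ.colLen 0

/-- The generating function
`φ(N, l, t, β) = (1-t²)^{N(N-1)/2} (1-βt)^N Σ_{ℓ(λ) ≤ l} t^{|λ|} β^{f(λ')} d_λ(N)`. -/
def phiGF (N l : ℕ) (t β : ℝ) : ℝ :=
  (1 - t ^ 2) ^ (N * (N - 1) / 2) * (1 - β * t) ^ N *
    ∑' μ : {μ : YoungDiagram // numRows μ ≤ l},
      t ^ (μ.1.card) * β ^ (oddCols μ.1) * (dCount N μ.1 : ℝ)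

/-- `b(N, j, m, l)`: the number of semistandard Young tableaux of size `2j+m`
with exactly `m` odd columns, at most `l` rows, and entries from `{1, …, N}`. -/
def bL (N j m l : ℕ) : ℕ :=
  Nat.card (Σ μ : {μ : YoungDiagram //
    μ.card = 2 * j + m ∧ oddCols μ = m ∧ numRows μ ≤ l}, SSYTN N μ.1)

/-- `b(N, j, m, ∞)`: the number of semistandard Young tableaux of size `2j+m`
with exactly `m` odd columns and entries from `{1, …, N}`. -/
def bInf (N j m : ℕ) : ℕ :=
  Nat.card (Σ μ : {μ : YoungDiagram // μ.card = 2 * j + m ∧ oddCols μ = m}, SSYTN N μ.1)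

/-- `p(N,j,m,l) = b(N,j,m,l) / b(N,j,m,∞)`. -/
def pRatio (N j m l : ℕ) : ℝ := (bL N j m l : ℝ) / (bInf N j m : ℝ)

/-- Last passage times of the array `A`: `lpp A i j` is the maximal weight of a monotone
lattice path inside the first `i` rows and `j` columns. -/
def lpp (A : ℕ → ℕ → ℕ) : ℕ → ℕ → ℕ
  | 0, _ => 0
  | _ + 1, 0 => 0
  | i + 1, j + 1 => max (lpp A i (j + 1)) (lpp A (i + 1) j) + A i j

/-- The array of entries bumped out of the first row by the RSK correspondence. -/
def bump (A : ℕ → ℕ → ℕ) (i j : ℕ) : ℕ :=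
  min (lpp A i (j + 1)) (lpp A (i + 1) j) - lpp A i j

/-- The growth diagram of `A` under RSK: `growth A r i j` is the `r`-th part of the partition
attached to the vertex `(i, j)`. -/
def growth (A : ℕ → ℕ → ℕ) (r i j : ℕ) : ℕ := lpp (bump^[r] A) i j

section Growth

variable (A B : ℕ → ℕ → ℕ)

lemma lpp_zero_left (j : ℕ) : lpp A 0 j = 0 := by simp [lpp]

lemma lpp_zero_right (i : ℕ) : lpp A i 0 = 0 := by cases i <;> simp [lpp]

lemma lpp_succ (i j : ℕ) :
    lpp A (i + 1) (j + 1) = max (lpp A i (j + 1)) (lpp A (i + 1) j) + A i j := by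
  rw [lpp]

lemma lpp_le_succ_right (i j : ℕ) : lpp A i j ≤ lpp A i (j + 1) := by
  cases i with
  | zero => simp [lpp_zero_left]
  | succ i => rw [lpp_succ]; omega

lemma lpp_le_succ_left (i j : ℕ) : lpp A i j ≤ lpp A (i + 1) j := by
  cases j with
  | zero => simp [lpp_zero_right]
  | succ j => rw [lpp_succ]; omega

lemma growth_zero (i j : ℕ) : growth A 0 i j = lpp A i j := rfl

lemma growth_succ (r i j : ℕ) : growth A (r + 1) i j = growth (bump A) r i j := rfl

lemma growth_zero_left (r j : ℕ) : growth A r 0 j = 0 := lpp_zero_left _ _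

lemma growth_zero_right (r i : ℕ) : growth A r i 0 = 0 := lpp_zero_right _ _

lemma growth_le_succ_right (r i j : ℕ) : growth A r i j ≤ growth A r i (j + 1) :=
  lpp_le_succ_right _ _ _

lemma growth_le_succ_left (r i j : ℕ) : growth A r i j ≤ growth A r (i + 1) j :=
  lpp_le_succ_left _ _ _

lemma growth_rule_zero (i j : ℕ) :
    growth A 0 (i + 1) (j + 1) = max (growth A 0 i (j + 1)) (growth A 0 (i + 1) j) + A i j :=
  lpp_succ _ _ _

lemma growth_rule_succ (r i j : ℕ) :
    growth A (r + 1) (i + 1) (j + 1) =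
      max (growth A (r + 1) i (j + 1)) (growth A (r + 1) (i + 1) j) +
        (min (growth A r i (j + 1)) (growth A r (i + 1) j) - growth A r i j) := by
  have : bump^[r + 1] A = bump (bump^[r] A) := Function.iterate_succ_apply' _ _ _
  simp only [growth]
  rw [lpp_succ, this]
  rfl

lemma growth_interlace (r i j : ℕ) :
    growth A (r + 1) i (j + 1) ≤ growth A r i j ∧ growth A (r + 1) (i + 1) j ≤ growth A r i j := by
  have key : ∀ n i j, i + j = n →
      growth A (r + 1) i (j + 1) ≤ growth A r i j ∧
        growth A (r + 1) (i + 1) j ≤ growth A r i j := by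
    intro n
    induction n using Nat.strong_induction_on with
    | _ n ih =>
      intro i j hn
      constructor
      · cases i with
        | zero => simp [growth_zero_left]
        | succ i =>
          have h := ih (i + j) (by omega) i j rfl
          have h1 := growth_le_succ_right A r i j
          have h2 := growth_le_succ_left A r i j
          rw [growth_rule_succ]
          omega
      · cases j with
        | zero => simp [growth_zero_right]
        | succ j =>
          have h := ih (i + j) (by omega) i j rfl
          have h1 := growth_le_succ_right A r i j
          have h2 := growth_le_succ_left A r i j
          rw [growth_rule_succ]
          omega
  exact key _ i j rfl

lemma growth_eq_zero {r i j : ℕ} (h : i ≤ r) : growth A r i j = 0 := by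
  induction i generalizing r with
  | zero => exact growth_zero_left _ _ _
  | succ i ih =>
    obtain ⟨r, rfl⟩ : ∃ s, r = s + 1 := ⟨r - 1, by omega⟩
    have := (growth_interlace A r i j).2
    have := ih (r := r) (by omega)
    omega

variable {A B}

lemma lpp_symm (hA : ∀ i j, A i j = A j i) (i j : ℕ) : lpp A i j = lpp A j i := by
  have key : ∀ n i j, i + j = n → lpp A i j = lpp A j i := by
    intro n
    induction n using Nat.strong_induction_on with
    | _ n ih =>
      intro i j hn
      cases i with
      | zero => simp [lpp_zero_left, lpp_zero_right]
      | succ i =>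
        cases j with
        | zero => simp [lpp_zero_left, lpp_zero_right]
        | succ j =>
          rw [lpp_succ, lpp_succ, ih (i + (j + 1)) (by omega) i (j + 1) rfl,
            ih (i + 1 + j) (by omega) (i + 1) j rfl, hA i j, max_comm]
  exact key _ i j rfl

lemma growth_symm (hA : ∀ i j, A i j = A j i) (r i j : ℕ) :
    growth A r i j = growth A r j i := by
  induction r generalizing A with
  | zero => exact lpp_symm hA i j
  | succ r ih =>
    rw [growth_succ, growth_succ]
    refine ih fun i j => ?_
    simp only [bump]
    rw [lpp_symm hA i j, lpp_symm hA i (j + 1), lpp_symm hA (i + 1) j, min_comm]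

lemma lpp_congr {p q : ℕ} (h : ∀ i < p, ∀ j < q, A i j = B i j) {i j : ℕ} (hi : i ≤ p)
    (hj : j ≤ q) : lpp A i j = lpp B i j := by
  induction i generalizing j with
  | zero => simp [lpp_zero_left]
  | succ i ihi =>
    induction j with
    | zero => simp [lpp_zero_right]
    | succ j ihj =>
      rw [lpp_succ, lpp_succ, ihi (by omega) hj, ihj (by omega), h i (by omega) j (by omega)]

lemma growth_congr {p q : ℕ} (h : ∀ i < p, ∀ j < q, A i j = B i j) {i j : ℕ} (hi : i ≤ p)
    (hj : j ≤ q) (r : ℕ) : growth A r i j = growth B r i j := by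
  induction r generalizing A B with
  | zero => exact lpp_congr h hi hj
  | succ r ih =>
    rw [growth_succ, growth_succ]
    refine ih fun i hi j hj => ?_
    simp only [bump]
    rw [lpp_congr h hi.le hj.le, lpp_congr h hi.le (show j + 1 ≤ q from hj),
      lpp_congr h (show i + 1 ≤ p from hi) hj.le]

/-- A chain of `k` positive entries of `A` inside the first `p` rows and `q` columns, with
strictly increasing row indices and strictly decreasing column indices. -/
def HasChain (A : ℕ → ℕ → ℕ) (p q k : ℕ) : Prop :=
  ∃ f g : ℕ → ℕ, (∀ s, s + 1 < k → f s < f (s + 1) ∧ g (s + 1) < g s) ∧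
    ∀ s < k, f s < p ∧ g s < q ∧ 0 < A (f s) (g s)

lemma HasChain.mono (h : ∀ i j, A i j ≤ B i j) {p q k : ℕ} (hA : HasChain A p q k) :
    HasChain B p q k := by
  obtain ⟨f, g, h1, h2⟩ := hA
  exact ⟨f, g, h1, fun s hs => ⟨(h2 s hs).1, (h2 s hs).2.1, (h2 s hs).2.2.trans_le (h _ _)⟩⟩

lemma bump_pos_iff {i j : ℕ} :
    0 < bump A i j ↔ lpp A i j < lpp A i (j + 1) ∧ lpp A i j < lpp A (i + 1) j := by
  simp only [bump]; omega

lemma exists_bump_pos {i j i' j' : ℕ} (h : 0 < A i j) (h' : 0 < A i' j') (hi : i < i')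
    (hj : j' < j) : ∃ p q, i < p ∧ p ≤ i' ∧ j' < q ∧ q ≤ j ∧ 0 < bump A p q := by
  by_contra! hno
  have hcon : ∀ p q, i < p → p ≤ i' → j' < q → q ≤ j → lpp A p q < lpp A p (q + 1) →
      ¬ lpp A p q < lpp A (p + 1) q := fun p q h1 h2 h3 h4 h5 h6 =>
    (hno p q h1 h2 h3 h4).not_gt (bump_pos_iff.2 ⟨h5, h6⟩)
  have hH : ∀ p, i + 1 ≤ p → p ≤ i' → lpp A p j < lpp A p (j + 1) := by
    intro p hp
    induction p, hp using Nat.le_induction with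
    | base => intro _; rw [lpp_succ]; omega
    | succ p hp ih =>
      intro hp'
      have h1 := ih (by omega)
      have h2 := hcon p j (by omega) (by omega) hj le_rfl h1
      rw [lpp_succ]; omega
  have hV : ∀ q, j' + 1 ≤ q → q ≤ j → lpp A i' q < lpp A (i' + 1) q := by
    intro q hq
    induction q, hq using Nat.le_induction with
    | base => intro _; rw [lpp_succ]; omega
    | succ q hq ih =>
      intro hq'
      have h1 := ih (by omega)
      have h2 := mt (hcon i' q hi le_rfl (by omega) (by omega)) (not_not.2 h1)
      rw [lpp_succ]; omega
  exact hcon i' j hi le_rfl hj le_rfl (hH i' hi le_rfl) (hV j hj le_rfl)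

lemma exists_pos_above {p q : ℕ} (h : lpp A p q < lpp A p (q + 1)) : ∃ i < p, 0 < A i q := by
  induction p with
  | zero => simp [lpp_zero_left] at h
  | succ p ih =>
    by_cases hA : 0 < A p q
    · exact ⟨p, by omega, hA⟩
    · have h1 : lpp A p q < lpp A p (q + 1) := by
        have := lpp_le_succ_left A p q
        rw [lpp_succ] at h; omega
      obtain ⟨i, hi, hi'⟩ := ih h1
      exact ⟨i, by omega, hi'⟩

lemma exists_pos_left {p q : ℕ} (h : lpp A p q < lpp A (p + 1) q) : ∃ j < q, 0 < A p j := by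
  induction q with
  | zero => simp [lpp_zero_right] at h
  | succ q ih =>
    by_cases hA : 0 < A p q
    · exact ⟨q, by omega, hA⟩
    · have h1 : lpp A p q < lpp A (p + 1) q := by
        have := lpp_le_succ_right A p q
        rw [lpp_succ] at h; omega
      obtain ⟨i, hi, hi'⟩ := ih h1
      exact ⟨i, by omega, hi'⟩

lemma exists_pos_of_bump_pos {p q p' q' : ℕ} (h : 0 < bump A p q) (h' : 0 < bump A p' q')
    (hp : p < p') (hq : q' < q) : ∃ i j, p ≤ i ∧ i < p' ∧ q' ≤ j ∧ j < q ∧ 0 < A i j := by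
  by_contra! hcon
  rw [bump_pos_iff] at h h'
  have hV : ∀ d, d + q' + 1 ≤ q → lpp A p (q - d) < lpp A (p + 1) (q - d) := by
    intro d
    induction d with
    | zero => intro _; exact h.2
    | succ d ih =>
      intro hd
      have h1 := ih (by omega)
      have h2 := hcon p (q - (d + 1)) le_rfl hp (by omega) (by omega)
      have h3 := lpp_le_succ_right A p (q - (d + 1))
      rw [show q - d = q - (d + 1) + 1 by omega, lpp_succ] at h1
      omega
  have hH : ∀ d, d + p + 1 ≤ p' → lpp A (p' - d) q' < lpp A (p' - d) (q' + 1) := by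
    intro d
    induction d with
    | zero => intro _; exact h'.1
    | succ d ih =>
      intro hd
      have h1 := ih (by omega)
      have h2 := hcon (p' - (d + 1)) q' (by omega) (by omega) le_rfl hq
      have h3 := lpp_le_succ_left A (p' - (d + 1)) q'
      rw [show p' - d = p' - (d + 1) + 1 by omega, lpp_succ] at h1
      omega
  have h1 := hV (q - q' - 1) (by omega)
  have h2 := hH (p' - p - 1) (by omega)
  have h3 := hcon p q' le_rfl hp le_rfl hq
  rw [show q - (q - q' - 1) = q' + 1 by omega, lpp_succ] at h1
  rw [show p' - (p' - p - 1) = p + 1 by omega, lpp_succ] at h2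
  omega

lemma hasChain_bump_iff {p q k : ℕ} :
    HasChain (bump A) p q (k + 1) ↔ HasChain A p q (k + 2) := by
  constructor
  · rintro ⟨f, g, h1, h2⟩
    have hfirst := exists_pos_above (bump_pos_iff.1 (h2 0 (by omega)).2.2).1
    have hlast := exists_pos_left (bump_pos_iff.1 (h2 k (by omega)).2.2).2
    obtain ⟨i₀, hi₀, hA₀⟩ := hfirst
    obtain ⟨j₁, hj₁, hA₁⟩ := hlast
    have hmid : ∀ s, ∃ i j, s < k → f s ≤ i ∧ i < f (s + 1) ∧ g (s + 1) ≤ j ∧ j < g s ∧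
        0 < A i j := by
      intro s
      by_cases hs : s < k
      · obtain ⟨i, j, h⟩ := exists_pos_of_bump_pos (h2 s (by omega)).2.2
          (h2 (s + 1) (by omega)).2.2 (h1 s (by omega)).1 (h1 s (by omega)).2
        exact ⟨i, j, fun _ => h⟩
      · exact ⟨0, 0, fun h => absurd h hs⟩
    choose F G hFG using hmid
    have hf0 := h2 0 (by omega)
    have hfk := h2 k (by omega)
    let F' : ℕ → ℕ := fun s => if s = 0 then i₀ else if s = k + 1 then f k else F (s - 1)
    let G' : ℕ → ℕ := fun s => if s = 0 then g 0 else if s = k + 1 then j₁ else G (s - 1)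
    have e0 : F' 0 = i₀ ∧ G' 0 = g 0 := by simp [F', G']
    have e1 : F' (k + 1) = f k ∧ G' (k + 1) = j₁ := by simp [F', G']
    have e2 : ∀ s, s < k → F' (s + 1) = F s ∧ G' (s + 1) = G s := by
      intro s hs
      have : s ≠ k := by omega
      simp [F', G', this]
    refine ⟨F', G', fun s hs => ?_, fun s hs => ?_⟩
    · rcases Nat.eq_zero_or_pos s with rfl | hs0
      · rcases Nat.eq_zero_or_pos k with rfl | hk
        · rw [e0.1, e0.2, e1.1, e1.2]; exact ⟨hi₀, hj₁⟩
        · have := hFG 0 hk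
          rw [e0.1, e0.2, (e2 0 hk).1, (e2 0 hk).2]; omega
      · obtain ⟨s, rfl⟩ : ∃ u, s = u + 1 := ⟨s - 1, by omega⟩
        have hs1 := hFG s (by omega)
        have es := e2 s (by omega)
        rw [es.1, es.2]
        by_cases hk : s + 1 = k
        · subst hk
          rw [e1.1, e1.2]; omega
        · have es' := e2 (s + 1) (by omega)
          have hs2 := hFG (s + 1) (by omega)
          rw [es'.1, es'.2]; omega
    · rcases Nat.eq_zero_or_pos s with rfl | hs0
      · rw [e0.1, e0.2]; exact ⟨by omega, by omega, hA₀⟩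
      · obtain ⟨s, rfl⟩ : ∃ u, s = u + 1 := ⟨s - 1, by omega⟩
        by_cases hk : s = k
        · subst hk
          rw [e1.1, e1.2]; exact ⟨by omega, by omega, hA₁⟩
        · have es := e2 s (by omega)
          have hs1 := hFG s (by omega)
          have := h2 s (by omega)
          have := h2 (s + 1) (by omega)
          rw [es.1, es.2]; exact ⟨by omega, by omega, hs1.2.2.2.2⟩
  · rintro ⟨f, g, h1, h2⟩
    have hmid : ∀ s, ∃ i j, s < k + 1 → f s < i ∧ i ≤ f (s + 1) ∧ g (s + 1) < j ∧ j ≤ g s ∧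
        0 < bump A i j := by
      intro s
      by_cases hs : s < k + 1
      · obtain ⟨i, j, h⟩ := exists_bump_pos (h2 s (by omega)).2.2
          (h2 (s + 1) (by omega)).2.2 (h1 s (by omega)).1 (h1 s (by omega)).2
        exact ⟨i, j, fun _ => h⟩
      · exact ⟨0, 0, fun h => absurd h hs⟩
    choose F G hFG using hmid
    refine ⟨F, G, fun s hs => ?_, fun s hs => ?_⟩
    · have := hFG s (by omega)
      have := hFG (s + 1) (by omega)
      omega
    · have := hFG s (by omega)
      have := h2 s (by omega)
      have := h2 (s + 1) (by omega)
      refine ⟨by omega, by omega, (hFG s (by omega)).2.2.2.2⟩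

lemma lpp_pos_iff {p q : ℕ} : 0 < lpp A p q ↔ ∃ i < p, ∃ j < q, 0 < A i j := by
  induction p generalizing q with
  | zero => simp [lpp_zero_left]
  | succ p ihp =>
    induction q with
    | zero => simp [lpp_zero_right]
    | succ q ihq =>
      rw [lpp_succ]
      have : 0 < max (lpp A p (q + 1)) (lpp A (p + 1) q) + A p q ↔
          0 < lpp A p (q + 1) ∨ 0 < lpp A (p + 1) q ∨ 0 < A p q := by omega
      rw [this, ihp, ihq]
      constructor
      · rintro (⟨i, hi, j, hj, h⟩ | ⟨i, hi, j, hj, h⟩ | h)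
        · exact ⟨i, by omega, j, hj, h⟩
        · exact ⟨i, hi, j, by omega, h⟩
        · exact ⟨p, by omega, q, by omega, h⟩
      · rintro ⟨i, hi, j, hj, h⟩
        by_cases hi' : i < p
        · exact Or.inl ⟨i, hi', j, hj, h⟩
        · by_cases hj' : j < q
          · exact Or.inr (Or.inl ⟨i, hi, j, hj', h⟩)
          · obtain rfl : i = p := by omega
            obtain rfl : j = q := by omega
            exact Or.inr (Or.inr h)

/-- Schensted's theorem for strictly decreasing chains. -/
lemma growth_pos_iff {r p q : ℕ} : 0 < growth A r p q ↔ HasChain A p q (r + 1) := by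
  induction r generalizing A with
  | zero =>
    rw [growth_zero, lpp_pos_iff]
    constructor
    · rintro ⟨i, hi, j, hj, h⟩
      exact ⟨fun _ => i, fun _ => j, fun s hs => by omega, fun s _ => ⟨hi, hj, h⟩⟩
    · rintro ⟨f, g, -, h⟩
      exact ⟨f 0, (h 0 (by omega)).1, g 0, (h 0 (by omega)).2.1, (h 0 (by omega)).2.2⟩
  | succ r ih => rw [growth_succ, ih, hasChain_bump_iff]

end Growth

section GrowthBijection

/-- One row of local rules can be inverted: a bottom boundary `ν` together with the top right
partition `μ` determines the top boundary `Q` and the entries `a` of the row. -/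
lemma exists_growth_row (n : ℕ) (ν : ℕ → ℕ → ℕ) (h0 : ∀ r, ν 0 r = 0)
    (hν : ∀ j < n, ∀ r, ν j r ≤ ν (j + 1) r ∧ ν (j + 1) (r + 1) ≤ ν j r) (μ : ℕ → ℕ)
    (hμ : ∀ r, μ r ≤ ν n r ∧ ν n (r + 1) ≤ μ r) :
    ∃ (Q : ℕ → ℕ → ℕ) (a : ℕ → ℕ), Q n = μ ∧ (∀ r, Q 0 r = 0) ∧
      (∀ j < n, ∀ r, Q j r ≤ Q (j + 1) r ∧ Q (j + 1) (r + 1) ≤ Q j r) ∧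
      ∀ j < n, ν (j + 1) 0 = max (Q (j + 1) 0) (ν j 0) + a j ∧
        ∀ r, ν (j + 1) (r + 1) = max (Q (j + 1) (r + 1)) (ν j (r + 1)) +
          (min (Q (j + 1) r) (ν j r) - Q j r) := by
  induction n generalizing μ with
  | zero =>
    refine ⟨fun _ => μ, fun _ => 0, rfl, fun r => ?_, by simp, by simp⟩
    have := (hμ r).1
    rw [h0] at this
    exact Nat.le_zero.1 this
  | succ n ih =>
    let lam : ℕ → ℕ := fun r =>
      min (μ r) (ν n r) - (ν (n + 1) (r + 1) - max (μ (r + 1)) (ν n (r + 1)))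
    have hlam : ∀ r, lam r =
      min (μ r) (ν n r) - (ν (n + 1) (r + 1) - max (μ (r + 1)) (ν n (r + 1))) := fun _ => rfl
    obtain ⟨Q, a, hQn, hQ0, hQ, hr⟩ := ih (fun j hj => hν j (by omega)) lam (fun r => by
      have h1 := hμ r
      have h2 := hν n (by omega) r
      have h3 := hμ (r + 1)
      have h4 := hν n (by omega) (r + 1)
      have := hlam r
      omega)
    refine ⟨fun j => if j = n + 1 then μ else Q j,
      fun j => if j = n then ν (n + 1) 0 - max (μ 0) (ν n 0) else a j, by simp, ?_, ?_, ?_⟩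
    · simpa using hQ0
    · intro j hj r
      by_cases hjn : j = n
      · subst hjn
        have h1 := hμ r
        have h2 := hν j (by omega) r
        have h3 := hμ (r + 1)
        have h4 := hν j (by omega) (r + 1)
        have := hlam r
        simp only [hQn, if_true, if_neg (show j ≠ j + 1 by omega)]
        omega
      · simpa only [if_neg (show j ≠ n + 1 by omega), if_neg (show j + 1 ≠ n + 1 by omega)]
          using hQ j (by omega) r
    · intro j hj
      by_cases hjn : j = n
      · subst hjn
        simp only [hQn, if_true, if_neg (show j ≠ j + 1 by omega)]
        constructor
        · have h1 := hμ 0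
          have h2 := hν j (by omega) 0
          omega
        · intro r
          have h1 := hμ r
          have h2 := hν j (by omega) r
          have h3 := hμ (r + 1)
          have h4 := hν j (by omega) (r + 1)
          have := hlam r
          omega
      · simpa only [if_neg (show j ≠ n + 1 by omega), if_neg (show j + 1 ≠ n + 1 by omega),
          if_neg hjn] using hr j (by omega)

/-- Every Gelfand-Tsetlin pattern is the boundary of the growth diagram of a symmetric array. -/
lemma exists_symm_growth (N : ℕ) (P : ℕ → ℕ → ℕ) (h0 : ∀ r, P 0 r = 0)
    (hP : ∀ j < N, ∀ r, P j r ≤ P (j + 1) r ∧ P (j + 1) (r + 1) ≤ P j r) :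
    ∃ A : ℕ → ℕ → ℕ, (∀ i j, A i j = A j i) ∧ ∀ j ≤ N, ∀ r, growth A r N j = P j r := by
  induction N generalizing P with
  | zero =>
    refine ⟨fun _ _ => 0, fun _ _ => rfl, fun j hj r => ?_⟩
    obtain rfl : j = 0 := by omega
    rw [growth_zero_left, h0]
  | succ N ih =>
    obtain ⟨Q, a, hQn, hQ0, hQ, hr⟩ := exists_growth_row (N + 1) P h0 hP (P N)
      (fun r => hP N (by omega) r)
    obtain ⟨A, hA, hAQ⟩ := ih Q hQ0 (fun j hj => hQ j (by omega))
    let B : ℕ → ℕ → ℕ := fun i j => if i < N ∧ j < N then A i j else a (min i j)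
    have hB : ∀ i j, B i j = B j i := by
      intro i j
      simp only [B, hA i j, min_comm i j, and_comm]
    have hBQ : ∀ j ≤ N, ∀ r, growth B r N j = Q j r := by
      intro j hj r
      rw [← hAQ j hj r]
      exact growth_congr (fun i hi j hj => by simp [B, hi, hj]) le_rfl hj r
    refine ⟨B, hB, fun j => ?_⟩
    induction j with
    | zero => intro _ r; rw [growth_zero_right, h0]
    | succ j ihj =>
      intro hj r
      have hj' := ihj (by omega)
      have hQj : ∀ r, growth B r N (j + 1) = Q (j + 1) r := by
        intro r
        by_cases hjN : j = N
        · subst hjN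
          rw [growth_symm hB, hj', hQn]
        · exact hBQ (j + 1) (by omega) r
      have hBa : B N j = a j := by
        simp [B, show min N j = j by omega]
      cases r with
      | zero => rw [growth_rule_zero, hj', hQj, hBa, (hr j (by omega)).1]
      | succ r =>
        rw [growth_rule_succ, hj', hj', hQj, hQj, hBQ j (by omega), (hr j (by omega)).2]

lemma eq_of_growth_eq {A B : ℕ → ℕ → ℕ} (hA : ∀ i j, A i j = A j i) (hB : ∀ i j, B i j = B j i)
    {N : ℕ} (h : ∀ j ≤ N, ∀ r, growth A r N j = growth B r N j) {i j : ℕ} (hi : i < N)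
    (hj : j < N) : A i j = B i j := by
  induction N generalizing i j with
  | zero => omega
  | succ N ih =>
    have step : ∀ j ≤ N, (∀ r, growth A r N (j + 1) = growth B r N (j + 1)) →
        (∀ r, growth A r N j = growth B r N j) ∧ A N j = B N j := by
      intro j hj hr
      constructor
      · intro r
        have h1 := h (j + 1) (by omega) (r + 1)
        rw [growth_rule_succ, growth_rule_succ, hr, hr, h j (by omega) (r + 1),
          h j (by omega) r] at h1
        have h2 := growth_le_succ_right A r N j
        have h3 := growth_le_succ_left A r N j
        have h4 := growth_le_succ_right B r N j
        have h5 := growth_le_succ_left B r N j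
        have h6 := hr r
        have h7 := h j (by omega) r
        omega
      · have h1 := h (j + 1) (by omega) 0
        rw [growth_rule_zero, growth_rule_zero, hr, h j (by omega) 0] at h1
        omega
    have hall : ∀ d ≤ N + 1, ∀ r, growth A r N (N + 1 - d) = growth B r N (N + 1 - d) := by
      intro d
      induction d with
      | zero =>
        intro _ r
        rw [Nat.sub_zero, growth_symm hA, growth_symm hB, h N (by omega)]
      | succ d ihd =>
        intro hd
        refine (step (N + 1 - (d + 1)) (by omega) ?_).1
        rw [show N + 1 - (d + 1) + 1 = N + 1 - d by omega]
        exact ihd (by omega)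
    have hall' : ∀ j ≤ N + 1, ∀ r, growth A r N j = growth B r N j := by
      intro j hj
      have := hall (N + 1 - j) (by omega)
      rwa [show N + 1 - (N + 1 - j) = j by omega] at this
    have hlast : ∀ j ≤ N, A N j = B N j := fun j hj => (step j hj (hall' (j + 1) (by omega))).2
    by_cases hi' : i < N
    · by_cases hj' : j < N
      · exact ih (fun j hj => hall' j (by omega)) hi' hj'
      · obtain rfl : j = N := by omega
        rw [hA, hB, hlast i (by omega)]
    · obtain rfl : i = N := by omega
      exact hlast j (by omega)

lemma sum_growth (A : ℕ → ℕ → ℕ) {i j R : ℕ} (hR : i ≤ R) :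
    ∑ r ∈ Finset.range R, growth A r i j =
      ∑ p ∈ Finset.range i, ∑ q ∈ Finset.range j, A p q := by
  induction i generalizing j with
  | zero => simp [growth_zero_left]
  | succ i ihi =>
    induction j with
    | zero => simp [growth_zero_right]
    | succ j ihj =>
      obtain ⟨S, rfl⟩ : ∃ S, R = S + 1 := ⟨R - 1, by omega⟩
      have h1 := ihi (j := j) (by omega)
      have h2 := ihi (j := j + 1) (by omega)
      have key : ∑ r ∈ Finset.range (S + 1), growth A r (i + 1) (j + 1) +
          ∑ r ∈ Finset.range (S + 1), growth A r i j =
          ∑ r ∈ Finset.range (S + 1), growth A r i (j + 1) +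
          ∑ r ∈ Finset.range (S + 1), growth A r (i + 1) j + A i j := by
        have e1 : ∑ r ∈ Finset.range (S + 1), growth A r i j =
            ∑ r ∈ Finset.range S, growth A r i j := by
          rw [Finset.sum_range_succ, growth_eq_zero A (show i ≤ S by omega), add_zero]
        have e2 : ∑ r ∈ Finset.range (S + 1), growth A r i (j + 1) +
            ∑ r ∈ Finset.range (S + 1), growth A r (i + 1) j =
            ∑ r ∈ Finset.range (S + 1), max (growth A r i (j + 1)) (growth A r (i + 1) j) +
            ∑ r ∈ Finset.range S, min (growth A r i (j + 1)) (growth A r (i + 1) j) := by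
          have : ∑ r ∈ Finset.range S, min (growth A r i (j + 1)) (growth A r (i + 1) j) =
              ∑ r ∈ Finset.range (S + 1), min (growth A r i (j + 1)) (growth A r (i + 1) j) := by
            rw [Finset.sum_range_succ, growth_eq_zero A (show i ≤ S by omega)]
            simp
          rw [this, ← Finset.sum_add_distrib, ← Finset.sum_add_distrib]
          exact Finset.sum_congr rfl fun r _ => (max_add_min _ _).symm
        rw [e1, e2, Finset.sum_range_succ', Finset.sum_range_succ' (fun r => max _ _),
          growth_rule_zero]
        have e3 : ∑ r ∈ Finset.range S, growth A (r + 1) (i + 1) (j + 1) +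
            ∑ r ∈ Finset.range S, growth A r i j =
            ∑ r ∈ Finset.range S, max (growth A (r + 1) i (j + 1)) (growth A (r + 1) (i + 1) j) +
            ∑ r ∈ Finset.range S, min (growth A r i (j + 1)) (growth A r (i + 1) j) := by
          rw [← Finset.sum_add_distrib, ← Finset.sum_add_distrib]
          refine Finset.sum_congr rfl fun r _ => ?_
          have h2 := growth_le_succ_right A r i j
          have h3 := growth_le_succ_left A r i j
          rw [growth_rule_succ]
          omega
        omega
      rw [h1, h2, ihj] at key
      simp only [Finset.sum_range_succ, Finset.sum_add_distrib] at key ⊢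
      omega

lemma alternating_sum_growth {A : ℕ → ℕ → ℕ} (hA : ∀ i j, A i j = A j i) {i R : ℕ}
    (hR : i ≤ R) :
    ∑ r ∈ Finset.range R, (-1 : ℤ) ^ r * (growth A r i i : ℤ) =
      ∑ p ∈ Finset.range i, (A p p : ℤ) := by
  induction i with
  | zero => simp [growth_zero_left]
  | succ i ih =>
    obtain ⟨S, rfl⟩ : ∃ S, R = S + 1 := ⟨R - 1, by omega⟩
    have ih := ih (by omega)
    rw [Finset.sum_range_succ (fun p => (A p p : ℤ)), ← ih, Finset.sum_range_succ',
      Finset.sum_range_succ (fun r => (-1 : ℤ) ^ r * (growth A r i i : ℤ)),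
      growth_eq_zero A (show i ≤ S by omega), growth_rule_zero, growth_symm hA 0 i (i + 1)]
    have e : ∀ r, (-1 : ℤ) ^ (r + 1) * (growth A (r + 1) (i + 1) (i + 1) : ℤ) =
        ((-1 : ℤ) ^ (r + 1) * (growth A (r + 1) (i + 1) i : ℤ) -
          (-1 : ℤ) ^ r * (growth A r (i + 1) i : ℤ)) + (-1 : ℤ) ^ r * (growth A r i i : ℤ) := by
      intro r
      have h3 := growth_le_succ_left A r i i
      rw [growth_rule_succ, growth_symm hA r i (i + 1), growth_symm hA (r + 1) i (i + 1),
        max_self, min_self]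
      push_cast [h3]
      ring
    rw [Finset.sum_congr rfl fun r _ => e r, Finset.sum_add_distrib,
      Finset.sum_range_sub (fun r => (-1 : ℤ) ^ r * (growth A r (i + 1) i : ℤ)),
      growth_symm hA S (i + 1) i, growth_eq_zero A (show i ≤ S by omega)]
    simp
    ring

end GrowthBijection

section Tableaux

lemma lt_card_filter_range_iff {p : ℕ → Prop} [DecidablePred p] {L : ℕ}
    (hp : ∀ a b, a ≤ b → b < L → p b → p a) (c : ℕ) :
    c < ((Finset.range L).filter p).card ↔ c < L ∧ p c := by
  induction L with
  | zero => simp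
  | succ L ih =>
    by_cases hL : p L
    · have : (Finset.range (L + 1)).filter p = Finset.range (L + 1) := by
        refine Finset.filter_true_of_mem fun x hx => ?_
        rw [Finset.mem_range] at hx
        exact hp x L (by omega) (by omega) hL
      rw [this, Finset.card_range]
      exact ⟨fun h => ⟨h, hp c L (by omega) (by omega) hL⟩, fun h => h.1⟩
    · rw [Finset.range_add_one, Finset.filter_insert, if_neg hL,
        ih fun a b h1 h2 => hp a b h1 (by omega)]
      refine ⟨fun h => ⟨by omega, h.2⟩, fun h => ⟨?_, h.2⟩⟩
      rcases Nat.lt_succ_iff_lt_or_eq.1 h.1 with h' | rfl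
      · exact h'
      · exact absurd h.2 hL

/-- The Gelfand-Tsetlin pattern of a tableau: the `r`-th part of the shape formed by the
entries that are at most `j`. -/
def gtPattern {N : ℕ} {μ : YoungDiagram} (T : SSYTN N μ) (j r : ℕ) : ℕ :=
  ((Finset.range (μ.rowLen r)).filter fun c => T.1 r c ≤ j).card

variable {N : ℕ} {μ : YoungDiagram}

lemma lt_gtPattern_iff (T : SSYTN N μ) (j r c : ℕ) :
    c < gtPattern T j r ↔ (r, c) ∈ μ ∧ T.1 r c ≤ j := by
  rw [YoungDiagram.mem_iff_lt_rowLen]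
  refine lt_card_filter_range_iff (p := fun c => T.1 r c ≤ j) (fun a b hab hb h => ?_) c
  exact (T.1.row_weak_of_le hab (YoungDiagram.mem_iff_lt_rowLen.2 hb)).trans h

lemma gtPattern_zero (T : SSYTN N μ) (r : ℕ) : gtPattern T 0 r = 0 := by
  by_contra h
  obtain ⟨h1, h2⟩ := (lt_gtPattern_iff T 0 r 0).1 (by omega)
  have := (Finset.mem_Icc.1 (T.2 r 0 h1)).1
  omega

lemma gtPattern_interlace (T : SSYTN N μ) (j r : ℕ) :
    gtPattern T j r ≤ gtPattern T (j + 1) r ∧ gtPattern T (j + 1) (r + 1) ≤ gtPattern T j r := by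
  constructor
  · refine le_of_forall_lt fun c hc => ?_
    rw [lt_gtPattern_iff] at hc ⊢
    exact ⟨hc.1, by omega⟩
  · refine le_of_forall_lt fun c hc => ?_
    rw [lt_gtPattern_iff] at hc ⊢
    have := T.1.col_strict (show r < r + 1 by omega) hc.1
    exact ⟨μ.up_left_mem (Nat.le_succ r) le_rfl hc.1, by omega⟩

lemma gtPattern_top (T : SSYTN N μ) (r : ℕ) : gtPattern T N r = μ.rowLen r := by
  refine eq_of_forall_lt_iff fun c => ?_
  rw [lt_gtPattern_iff, YoungDiagram.mem_iff_lt_rowLen]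
  refine ⟨fun h => h.1, fun h => ⟨h, ?_⟩⟩
  exact (Finset.mem_Icc.1 (T.2 r c (YoungDiagram.mem_iff_lt_rowLen.2 h))).2

lemma sigma_ext_of_gtPattern {τ τ' : Σ μ, SSYTN N μ}
    (h : ∀ j ≤ N, ∀ r, gtPattern τ.2 j r = gtPattern τ'.2 j r) : τ = τ' := by
  obtain ⟨μ, T⟩ := τ
  obtain ⟨μ', T'⟩ := τ'
  obtain rfl : μ = μ' := by
    ext ⟨r, c⟩
    have := h N le_rfl r
    simp only [gtPattern_top] at this
    rw [YoungDiagram.mem_cells, YoungDiagram.mem_cells, YoungDiagram.mem_iff_lt_rowLen,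
      YoungDiagram.mem_iff_lt_rowLen, this]
  congr 1
  refine Subtype.ext (SemistandardYoungTableau.ext fun r c => ?_)
  by_cases hc : (r, c) ∈ μ
  · have key : ∀ j ≤ N, T.1 r c ≤ j ↔ T'.1 r c ≤ j := by
      intro j hj
      have h1 := lt_gtPattern_iff T j r c
      have h2 := lt_gtPattern_iff T' j r c
      rw [show gtPattern T j r = gtPattern T' j r from h j hj r] at h1
      simp only [hc, true_and] at h1 h2
      rw [← h1, h2]
    have h1 := (Finset.mem_Icc.1 (T.2 r c hc)).2
    have h2 := (Finset.mem_Icc.1 (T'.2 r c hc)).2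
    exact le_antisymm ((key _ h2).2 le_rfl) ((key _ h1).1 le_rfl)
  · rw [T.1.zeros hc, T'.1.zeros hc]

lemma exists_tableau_of_interlace {P : ℕ → ℕ → ℕ} (h0 : ∀ r, P 0 r = 0)
    (hP : ∀ j < N, ∀ r, P j r ≤ P (j + 1) r ∧ P (j + 1) (r + 1) ≤ P j r) :
    ∃ τ : Σ μ, SSYTN N μ, ∀ j ≤ N, ∀ r, gtPattern τ.2 j r = P j r := by
  have hanti : ∀ r, P N (r + 1) ≤ P N r := by
    intro r
    rcases Nat.eq_zero_or_pos N with h | h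
    · rw [h, h0, h0]
    · have := hP (N - 1) (by omega) r
      rw [show N - 1 + 1 = N by omega] at this
      omega
  have hanti' : Antitone (P N) := antitone_nat_of_succ_le hanti
  have hzero : ∀ j ≤ N, ∀ r, j ≤ r → P j r = 0 := by
    intro j
    induction j with
    | zero => intro _ r _; exact h0 r
    | succ j ih =>
      intro hj r hr
      obtain ⟨r, rfl⟩ : ∃ s, r = s + 1 := ⟨r - 1, by omega⟩
      have := (hP j (by omega) r).2
      have := ih (by omega) r (by omega)
      omega
  have hmono : ∀ r, ∀ j k, j ≤ k → k ≤ N → P j r ≤ P k r := by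
    intro r j k hjk
    induction k, hjk using Nat.le_induction with
    | base => intro _; rfl
    | succ k hk ih => intro hk'; exact (ih (by omega)).trans (hP k (by omega) r).1
  let μ : YoungDiagram :=
    { cells := (Finset.range N ×ˢ Finset.range (P N 0)).filter fun x => x.2 < P N x.1
      isLowerSet := by
        rintro ⟨r, c⟩ ⟨r', c'⟩ ⟨hr, hc⟩ h
        simp only [Finset.coe_filter, Finset.mem_product, Finset.mem_range,
          Set.mem_ofPred_eq] at h hr hc ⊢
        have := hanti' hr
        omega }
  have hμ : ∀ r c, (r, c) ∈ μ ↔ c < P N r := by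
    intro r c
    rw [← YoungDiagram.mem_cells]
    simp only [μ, Finset.mem_filter, Finset.mem_product, Finset.mem_range]
    refine ⟨fun h => h.2, fun h => ⟨⟨?_, ?_⟩, h⟩⟩
    · by_contra hr
      rw [hzero N le_rfl r (by omega)] at h
      omega
    · exact h.trans_le (hanti' (Nat.zero_le r))
  let E : ℕ → ℕ → ℕ := fun r c => ((Finset.range N).filter fun j => P j r ≤ c).card
  have hE : ∀ r c j, c < P N r → j ≤ N → (E r c ≤ j ↔ c < P j r) := by
    intro r c j hc hj
    rcases Nat.lt_or_ge j N with hjN | hjN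
    · have := lt_card_filter_range_iff (p := fun j => P j r ≤ c) (L := N)
        (fun a b hab hb h => (hmono r a b hab (by omega)).trans h) j
      rw [← not_lt, show j < E r c ↔ _ from this]
      simp only [hjN, true_and, not_le]
    · obtain rfl : j = N := by omega
      refine ⟨fun _ => hc, fun _ => ?_⟩
      exact (Finset.card_filter_le _ _).trans (Finset.card_range _).le
  have hEle : ∀ r c, E r c ≤ N := fun r c =>
    (Finset.card_filter_le _ _).trans (Finset.card_range _).le
  let T : SemistandardYoungTableau μ :=
    { entry := fun r c => if (r, c) ∈ μ then E r c else 0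
      row_weak' := by
        intro r c c' hc hm
        rw [if_pos hm, if_pos (μ.up_left_mem le_rfl hc.le hm)]
        refine Finset.card_le_card fun j hj => ?_
        simp only [Finset.mem_filter] at hj ⊢
        exact ⟨hj.1, hj.2.trans hc.le⟩
      col_strict' := by
        intro r r' c hr hm
        have hm' := μ.up_left_mem hr.le le_rfl hm
        have hm1 := μ.up_left_mem (show r + 1 ≤ r' from hr) le_rfl hm
        rw [if_pos hm, if_pos hm']
        rw [hμ] at hm hm' hm1
        have step : E r c < E (r + 1) c := by
          have hpos : 1 ≤ E (r + 1) c := by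
            by_contra hlt
            have := (hE (r + 1) c 0 hm1 (by omega)).1 (by omega)
            rw [h0] at this
            omega
          have h1 := (hE (r + 1) c (E (r + 1) c) hm1 (hEle _ _)).1 le_rfl
          have h2 := (hP (E (r + 1) c - 1) (by have := hEle (r + 1) c; omega) r).2
          rw [show E (r + 1) c - 1 + 1 = E (r + 1) c by omega] at h2
          have h3 := (hE r c (E (r + 1) c - 1) hm' (by have := hEle (r + 1) c; omega)).2
            (by omega)
          omega
        have hle : E (r + 1) c ≤ E r' c := by
          have h1 := (hE r' c (E r' c) hm (hEle _ _)).1 le_rfl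
          refine (hE (r + 1) c _ hm1 (hEle _ _)).2 (h1.trans_le ?_)
          have hj : ∀ j ≤ N, P j r' ≤ P j (r + 1) := by
            intro j hj
            have hanti_j : ∀ s, P j (s + 1) ≤ P j s := by
              intro s
              rcases Nat.eq_zero_or_pos j with h | h
              · rw [h, h0, h0]
              · have := hP (j - 1) (by omega) s
                rw [show j - 1 + 1 = j by omega] at this
                omega
            exact antitone_nat_of_succ_le hanti_j hr
          exact hj _ (hEle _ _)
        omega
      zeros' := fun hm => if_neg hm }
  have hT : ∀ r c, (r, c) ∈ μ → T r c = E r c := fun r c hm => if_pos hm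
  refine ⟨⟨μ, T, fun r c hm => ?_⟩, fun j hj r => ?_⟩
  · rw [hT r c hm, Finset.mem_Icc]
    refine ⟨?_, hEle _ _⟩
    by_contra hlt
    have := (hE r c 0 ((hμ r c).1 hm) (by omega)).1 (by omega)
    rw [h0] at this
    omega
  · refine eq_of_forall_lt_iff fun c => ?_
    rw [lt_gtPattern_iff]
    constructor
    · rintro ⟨hm, hle⟩
      rw [show T r c = E r c from hT r c hm] at hle
      exact (hE r c j ((hμ r c).1 hm) hj).1 hle
    · intro hc
      have hc' := hc.trans_le (hmono r j N hj le_rfl)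
      have hm := (hμ r c).2 hc'
      refine ⟨hm, ?_⟩
      rw [show T r c = E r c from hT r c hm]
      exact (hE r c j hc' hj).2 hc

lemma YoungDiagram.card_eq_sum_rowLen (μ : YoungDiagram) {R : ℕ} (hR : μ.colLen 0 ≤ R) :
    μ.card = ∑ r ∈ Finset.range R, μ.rowLen r := by
  have hmem : ∀ x ∈ μ.cells, x.1 ∈ Finset.range R := by
    rintro ⟨r, c⟩ h
    have h1 := μ.up_left_mem le_rfl (Nat.zero_le c) ((YoungDiagram.mem_cells _).1 h)
    rw [YoungDiagram.mem_iff_lt_colLen] at h1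
    exact Finset.mem_range.2 (h1.trans_le hR)
  rw [YoungDiagram.card, Finset.card_eq_sum_card_fiberwise hmem]
  exact Finset.sum_congr rfl fun r _ => (μ.rowLen_eq_card).symm

lemma sum_range_alternating (n : ℕ) :
    ∑ r ∈ Finset.range n, (-1 : ℤ) ^ r = if Odd n then 1 else 0 := by
  induction n with
  | zero => simp
  | succ n ih =>
    rw [Finset.sum_range_succ, ih]
    rcases Nat.even_or_odd n with h | h
    · simp [h, Nat.not_odd_iff_even.2 h, h.add_one]
    · simp [h, h.neg_one_pow, Nat.not_odd_iff_even.2 h.add_one]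

lemma oddCols_eq_alternating_sum (μ : YoungDiagram) {R : ℕ} (hR : μ.colLen 0 ≤ R) :
    (oddCols μ : ℤ) = ∑ r ∈ Finset.range R, (-1 : ℤ) ^ r * (μ.rowLen r : ℤ) := by
  have hcard : ∀ r, μ.rowLen r ≤ μ.card := by
    intro r
    rw [μ.rowLen_eq_card]
    exact Finset.card_le_card (Finset.filter_subset _ _)
  have h1 : ∀ r, (μ.rowLen r : ℤ) =
      ∑ c ∈ Finset.range μ.card, if (r, c) ∈ μ then (1 : ℤ) else 0 := by
    intro r
    rw [Finset.sum_boole]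
    congr 1
    have : (Finset.range μ.card).filter (fun c => (r, c) ∈ μ) = Finset.range (μ.rowLen r) := by
      ext c
      have := hcard r
      simp only [Finset.mem_filter, Finset.mem_range, YoungDiagram.mem_iff_lt_rowLen]
      omega
    rw [this, Finset.card_range]
  have h2 : ∀ c, ∑ r ∈ Finset.range R, (-1 : ℤ) ^ r * (if (r, c) ∈ μ then (1 : ℤ) else 0) =
      if Odd (μ.colLen c) then 1 else 0 := by
    intro c
    rw [← sum_range_alternating]
    simp only [mul_ite, mul_one, mul_zero, ← Finset.sum_filter]
    refine Finset.sum_congr ?_ fun _ _ => rfl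
    ext r
    have := μ.colLen_anti 0 c (Nat.zero_le c)
    simp only [Finset.mem_filter, Finset.mem_range, YoungDiagram.mem_iff_lt_colLen]
    omega
  simp only [h1, Finset.mul_sum]
  rw [Finset.sum_comm, Finset.sum_congr rfl fun c _ => h2 c, Finset.sum_boole, oddCols]

end Tableaux

section SymmetricArrays

variable {N : ℕ}

/-- The symmetric array with diagonal entries `x.1` and entries `x.2` below the diagonal,
extended by zero. -/
def symmArray (x : (Fin N → ℕ) × ((Σ j : Fin N, Fin j) → ℕ)) (i j : ℕ) : ℕ :=
  (if h : i = j ∧ j < N then x.1 ⟨j, h.2⟩ else 0) +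
    ((if h : i < j ∧ j < N then x.2 ⟨⟨j, h.2⟩, ⟨i, h.1⟩⟩ else 0) +
      (if h : j < i ∧ i < N then x.2 ⟨⟨i, h.2⟩, ⟨j, h.1⟩⟩ else 0))

variable (x y : (Fin N → ℕ) × ((Σ j : Fin N, Fin j) → ℕ))

lemma symmArray_diag (i : Fin N) : symmArray x i i = x.1 i := by
  simp [symmArray]

lemma symmArray_lt (s : Σ j : Fin N, Fin j) : symmArray x s.2 s.1 = x.2 s := by
  have h1 := s.2.2
  have h2 := s.1.2
  simp [symmArray, h1.ne, h1.not_gt, h1]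

lemma symmArray_symm (i j : ℕ) : symmArray x i j = symmArray x j i := by
  rcases lt_trichotomy i j with h | rfl | h
  · simp [symmArray, h, h.not_gt, h.ne, h.ne']
  · rfl
  · simp [symmArray, h, h.not_gt, h.ne, h.ne']

lemma symmArray_eq {A : ℕ → ℕ → ℕ} (hA : ∀ i j, A i j = A j i) (h1 : ∀ i, x.1 i = A i i)
    (h2 : ∀ s, x.2 s = A s.2 s.1) : ∀ i < N, ∀ j < N, symmArray x i j = A i j := by
  intro i hi j hj
  rcases lt_trichotomy i j with h | rfl | h
  · exact (symmArray_lt x ⟨⟨j, hj⟩, ⟨i, h⟩⟩).trans (h2 _)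
  · exact (symmArray_diag x ⟨i, hi⟩).trans (h1 _)
  · rw [symmArray_symm, hA]
    exact (symmArray_lt x ⟨⟨i, hi⟩, ⟨j, h⟩⟩).trans (h2 _)

variable {x y} in
lemma symmArray_mono (h : x ≤ y) (i j : ℕ) : symmArray x i j ≤ symmArray y i j := by
  unfold symmArray
  have h1 := h.1
  have h2 := h.2
  gcongr ?_ + (?_ + ?_)
  · split_ifs
    · exact h1 _
    · rfl
  · split_ifs
    · exact h2 _
    · rfl
  · split_ifs
    · exact h2 _
    · rfl

lemma sum_symmArray_diag : ∑ p ∈ Finset.range N, symmArray x p p = ∑ i, x.1 i := by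
  rw [Finset.sum_range]
  exact Finset.sum_congr rfl fun i _ => symmArray_diag x i

lemma sum_symmArray : ∑ p ∈ Finset.range N, ∑ q ∈ Finset.range N, symmArray x p q =
    ∑ i, x.1 i + 2 * ∑ s, x.2 s := by
  have hoff : ∑ q ∈ Finset.range N, ∑ p ∈ Finset.range N,
      (if h : p < q ∧ q < N then x.2 ⟨⟨q, h.2⟩, ⟨p, h.1⟩⟩ else 0) = ∑ s, x.2 s := by
    rw [Finset.sum_range, Fintype.sum_sigma]
    refine Finset.sum_congr rfl fun q _ => ?_
    rw [← Finset.sum_subset (Finset.range_subset_range.2 q.2.le), Finset.sum_range]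
    · exact Finset.sum_congr rfl fun p _ => by simp
    · intro p _ hp
      rw [Finset.mem_range] at hp
      simp [hp]
  have hdiag : ∑ p ∈ Finset.range N, ∑ q ∈ Finset.range N,
      (if h : p = q ∧ q < N then x.1 ⟨q, h.2⟩ else 0) = ∑ i, x.1 i := by
    rw [Finset.sum_range]
    refine Finset.sum_congr rfl fun p _ => ?_
    rw [Finset.sum_eq_single_of_mem (p : ℕ) (Finset.mem_range.2 p.2)]
    · simp
    · intro q _ hq
      simp [hq.symm]
  simp only [symmArray, Finset.sum_add_distrib]
  rw [hdiag, hoff, Finset.sum_comm, hoff]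
  ring

/-- Tableaux with entries in `{1, …, N}` correspond to symmetric `N × N` arrays. -/
lemma exists_tableau_equiv (N : ℕ) :
    ∃ e : (Σ μ, SSYTN N μ) ≃ (Fin N → ℕ) × ((Σ j : Fin N, Fin j) → ℕ),
      ∀ τ : (Σ μ, SSYTN N μ), ∀ j ≤ N, ∀ r,
        growth (symmArray (e τ)) r N j = gtPattern τ.2 j r := by
  have hex : ∀ τ : (Σ μ, SSYTN N μ), ∃ x : (Fin N → ℕ) × ((Σ j : Fin N, Fin j) → ℕ),
      ∀ j ≤ N, ∀ r, growth (symmArray x) r N j = gtPattern τ.2 j r := by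
    intro τ
    obtain ⟨A, hA, h⟩ := exists_symm_growth N (gtPattern τ.2) (gtPattern_zero τ.2)
      fun j _ r => gtPattern_interlace τ.2 j r
    let x : (Fin N → ℕ) × ((Σ j : Fin N, Fin j) → ℕ) := (fun i => A i i, fun s => A s.2 s.1)
    refine ⟨x, fun j hj r => ?_⟩
    rw [← h j hj r]
    exact growth_congr (symmArray_eq x hA (fun _ => rfl) fun _ => rfl) le_rfl hj r
  choose f hf using hex
  refine ⟨Equiv.ofBijective f ⟨fun τ τ' h => ?_, fun x => ?_⟩, hf⟩
  · refine sigma_ext_of_gtPattern fun j hj r => ?_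
    rw [← hf τ j hj r, ← hf τ' j hj r, h]
  · obtain ⟨τ, hτ⟩ := exists_tableau_of_interlace (N := N)
      (P := fun j r => growth (symmArray x) r N j) (fun r => growth_zero_right _ _ _)
      (fun j _ r => ⟨growth_le_succ_right _ _ _ _, (growth_interlace _ _ _ _).1⟩)
    refine ⟨τ, ?_⟩
    have key : ∀ i < N, ∀ j < N, symmArray (f τ) i j = symmArray x i j := fun i hi j hj =>
      eq_of_growth_eq (symmArray_symm _) (symmArray_symm _)
        (fun j hj r => by rw [hf τ j hj r, hτ j hj r]) hi hj
    refine Prod.ext (funext fun i => ?_) (funext fun s => ?_)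
    · rw [← symmArray_diag, ← symmArray_diag, key i i.2 i i.2]
    · rw [← symmArray_lt, ← symmArray_lt, key s.2 (s.2.2.trans s.1.2) s.1 s.1.2]

section Statistics

variable {τ : Σ μ, SSYTN N μ} {x}
  (hτ : ∀ j ≤ N, ∀ r, growth (symmArray x) r N j = gtPattern τ.2 j r)

include hτ in
lemma rowLen_eq_growth (r : ℕ) : τ.1.rowLen r = growth (symmArray x) r N N := by
  rw [hτ N le_rfl, gtPattern_top]

include hτ in
lemma card_eq_of_growth : τ.1.card = 2 * ∑ s, x.2 s + ∑ i, x.1 i := by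
  rw [τ.1.card_eq_sum_rowLen (le_max_left _ N)]
  simp only [rowLen_eq_growth hτ]
  rw [sum_growth _ (le_max_right _ N), sum_symmArray, add_comm]

include hτ in
lemma oddCols_eq_of_growth : oddCols τ.1 = ∑ i, x.1 i := by
  have h := oddCols_eq_alternating_sum τ.1 (le_max_left _ N)
  simp only [rowLen_eq_growth hτ] at h
  rw [alternating_sum_growth (symmArray_symm x) (le_max_right _ N)] at h
  rw [← sum_symmArray_diag]
  exact_mod_cast h

include hτ in
lemma numRows_le_iff_of_growth (l : ℕ) :
    numRows τ.1 ≤ l ↔ ¬ HasChain (symmArray x) N N (l + 1) := by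
  rw [← growth_pos_iff, ← rowLen_eq_growth hτ, ← YoungDiagram.mem_iff_lt_rowLen,
    YoungDiagram.mem_iff_lt_colLen, numRows, not_lt]

end Statistics

end SymmetricArrays

section Counting

variable {κ : Type*} [Fintype κ] [DecidableEq κ]

lemma mem_piAntidiag_univ {n : ℕ} {a : κ → ℕ} :
    a ∈ Finset.piAntidiag Finset.univ n ↔ ∑ k, a k = n := by
  simp [Finset.mem_piAntidiag]

/-- Double counting of pairs (function, decrement), for a family of functions closed under
decreasing. -/
lemma card_piAntidiag_succ_le {S : (κ → ℕ) → Prop} [DecidablePred S]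
    (hS : ∀ a b, a ≤ b → S b → S a) (j : ℕ) :
    (j + 1) * ((Finset.piAntidiag Finset.univ (j + 1)).filter S).card ≤
      (Fintype.card κ + j) * ((Finset.piAntidiag Finset.univ j).filter S).card := by
  have h1 : ∀ k : κ, ∑ b ∈ (Finset.piAntidiag Finset.univ (j + 1)).filter S, b k ≤
      ∑ a ∈ (Finset.piAntidiag Finset.univ j).filter S, (a k + 1) := by
    intro k
    have h2 : ∑ b ∈ ((Finset.piAntidiag Finset.univ (j + 1)).filter S).filter (fun b => b k ≠ 0),
        b k = ∑ b ∈ (Finset.piAntidiag Finset.univ (j + 1)).filter S, b k :=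
      Finset.sum_filter_of_ne fun _ _ h => h
    rw [← h2]
    have h3 : ∀ b ∈ ((Finset.piAntidiag Finset.univ (j + 1)).filter S).filter (fun b => b k ≠ 0),
        b = (b - Pi.single k 1) + Pi.single k 1 := by
      intro b hb
      rw [Finset.mem_filter] at hb
      funext i
      by_cases hi : i = k
      · subst hi
        have := hb.2
        simp only [Pi.add_apply, Pi.sub_apply, Pi.single_eq_same]
        omega
      · simp [hi]
    calc _ = ∑ b ∈ ((Finset.piAntidiag Finset.univ (j + 1)).filter S).filter
          (fun b => b k ≠ 0), ((b - Pi.single k 1 : κ → ℕ) k + 1) := by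
          refine Finset.sum_congr rfl fun b hb => ?_
          have h4 := (Finset.mem_filter.1 hb).2
          simp only [Pi.sub_apply, Pi.single_eq_same]
          omega
      _ = ∑ a ∈ (((Finset.piAntidiag Finset.univ (j + 1)).filter S).filter
          (fun b => b k ≠ 0)).image (fun b => b - Pi.single k 1), (a k + 1) := by
          rw [Finset.sum_image]
          intro b hb b' hb' h
          rw [h3 b hb, h3 b' hb', show b - Pi.single k 1 = b' - Pi.single k 1 from h]
      _ ≤ _ := by
          refine Finset.sum_le_sum_of_subset fun a ha => ?_
          obtain ⟨b, hb, rfl⟩ := Finset.mem_image.1 ha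
          have h4 := h3 b hb
          rw [Finset.mem_filter, Finset.mem_filter, mem_piAntidiag_univ] at hb
          rw [Finset.mem_filter, mem_piAntidiag_univ]
          refine ⟨?_, hS _ b tsub_le_self hb.1.2⟩
          have h5 := hb.1.1
          rw [h4] at h5
          simp only [Pi.add_apply, Finset.sum_add_distrib, Finset.sum_pi_single',
            Finset.mem_univ, if_true] at h5
          simpa using h5
  have h2 := Finset.sum_le_sum fun k (_ : k ∈ Finset.univ) => h1 k
  rw [Finset.sum_comm, Finset.sum_comm (s := Finset.univ)] at h2
  have h3 : ∀ b ∈ (Finset.piAntidiag Finset.univ (j + 1)).filter S, ∑ k, b k = j + 1 :=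
    fun b hb => mem_piAntidiag_univ.1 (Finset.mem_filter.1 hb).1
  have h4 : ∀ b ∈ (Finset.piAntidiag Finset.univ j).filter S,
      ∑ k, (b k + 1) = Fintype.card κ + j := by
    intro b hb
    rw [Finset.sum_add_distrib, mem_piAntidiag_univ.1 (Finset.mem_filter.1 hb).1]
    simp [add_comm]
  rw [Finset.sum_congr rfl h3, Finset.sum_congr rfl h4, Finset.sum_const, Finset.sum_const,
    smul_eq_mul, smul_eq_mul, mul_comm, mul_comm _ (Fintype.card κ + j)] at h2
  exact h2

lemma card_piAntidiag_univ (n : ℕ) :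
    (Finset.piAntidiag (Finset.univ : Finset κ) n).card = (Fintype.card κ).multichoose n := by
  rw [← Finset.map_sym_eq_piAntidiag, Finset.card_map, Finset.sym_univ,
    Finset.card_univ, Sym.card_sym_eq_multichoose]

lemma succ_mul_multichoose_succ (n j : ℕ) :
    (j + 1) * n.multichoose (j + 1) = (n + j) * n.multichoose j := by
  rcases n with _ | n
  · rcases j with _ | j <;> simp
  · rw [Nat.multichoose_eq, Nat.multichoose_eq]
    have := Nat.add_one_mul_choose_eq (n + j) j
    rw [show n + 1 + (j + 1) - 1 = n + j + 1 by omega, show n + 1 + j - 1 = n + j by omega,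
      mul_comm, ← this, add_right_comm n j 1]

lemma card_piAntidiag_cross_le {S : (κ → ℕ) → Prop} [DecidablePred S]
    (hS : ∀ a b, a ≤ b → S b → S a) (j : ℕ) :
    ((Finset.piAntidiag Finset.univ (j + 1)).filter S).card * (Fintype.card κ).multichoose j ≤
      ((Finset.piAntidiag Finset.univ j).filter S).card *
        (Fintype.card κ).multichoose (j + 1) := by
  have h1 := Nat.mul_le_mul_right ((Fintype.card κ).multichoose j) (card_piAntidiag_succ_le hS j)
  have h2 := succ_mul_multichoose_succ (Fintype.card κ) j
  refine Nat.le_of_mul_le_mul_left (c := j + 1) ?_ (by omega)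
  rw [← mul_assoc, mul_left_comm (j + 1), h2]
  exact h1.trans_eq (by ring)

end Counting

section Ratio

lemma card_sigma_fin (N : ℕ) : Fintype.card (Σ j : Fin N, Fin j) = N * (N - 1) / 2 := by
  rw [Fintype.card_sigma]
  simp only [Fintype.card_fin]
  rw [Fin.sum_univ_eq_sum_range (fun i => i) N, Finset.sum_range_id]

/-- Symmetric arrays with trace `m`, sum `j` below the diagonal and no long chain. -/
def arrayFinset (N j m l : ℕ) : Finset ((Fin N → ℕ) × ((Σ j : Fin N, Fin j) → ℕ)) :=
  (Finset.piAntidiag Finset.univ m ×ˢ Finset.piAntidiag Finset.univ j).filter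
    fun x => ¬ HasChain (symmArray x) N N (l + 1)

lemma nonempty_sigma_equiv {N : ℕ} (P : YoungDiagram → Prop)
    (s : Finset ((Fin N → ℕ) × ((Σ j : Fin N, Fin j) → ℕ)))
    (h : ∀ (τ : Σ μ, SSYTN N μ) (x : (Fin N → ℕ) × ((Σ j : Fin N, Fin j) → ℕ)),
      (∀ j ≤ N, ∀ r, growth (symmArray x) r N j = gtPattern τ.2 j r) → (P τ.1 ↔ x ∈ s)) :
    Nonempty ((Σ μ : {μ : YoungDiagram // P μ}, SSYTN N μ.1) ≃ s) := by
  obtain ⟨e, he⟩ := exists_tableau_equiv N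
  exact ⟨(Equiv.subtypeSigmaEquiv (fun μ => SSYTN N μ) P).symm.trans
    (e.subtypeEquiv fun τ => h τ (e τ) (he τ))⟩

lemma nonempty_equiv_arrayFinset (N j m l : ℕ) :
    Nonempty ((Σ μ : {μ : YoungDiagram //
      μ.card = 2 * j + m ∧ oddCols μ = m ∧ numRows μ ≤ l}, SSYTN N μ.1) ≃
        arrayFinset N j m l) := by
  refine nonempty_sigma_equiv _ _ fun τ x hτ => ?_
  rw [arrayFinset, Finset.mem_filter, Finset.mem_product, mem_piAntidiag_univ,
    mem_piAntidiag_univ, numRows_le_iff_of_growth hτ, card_eq_of_growth hτ,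
    oddCols_eq_of_growth hτ, ← and_assoc]
  refine and_congr_left' ?_
  constructor <;> rintro ⟨h1, h2⟩ <;> constructor <;> omega

lemma bL_eq (N j m l : ℕ) : bL N j m l = (arrayFinset N j m l).card := by
  obtain ⟨e⟩ := nonempty_equiv_arrayFinset N j m l
  rw [bL, Nat.card_congr e, Nat.card_eq_fintype_card, Fintype.card_coe]

lemma bInf_eq (N j m : ℕ) :
    bInf N j m = N.multichoose m * (N * (N - 1) / 2).multichoose j := by
  have : bInf N j m = (Finset.piAntidiag (Finset.univ : Finset (Fin N)) m ×ˢ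
      Finset.piAntidiag (Finset.univ : Finset (Σ j : Fin N, Fin j)) j).card := by
    obtain ⟨e⟩ := nonempty_sigma_equiv (N := N)
      (fun μ => μ.card = 2 * j + m ∧ oddCols μ = m) (Finset.piAntidiag Finset.univ m ×ˢ
        Finset.piAntidiag Finset.univ j) (by
        intro τ x hτ
        rw [Finset.mem_product, mem_piAntidiag_univ,
          mem_piAntidiag_univ, card_eq_of_growth hτ, oddCols_eq_of_growth hτ]
        constructor <;> rintro ⟨h1, h2⟩ <;> constructor <;> omega)
    rw [bInf, Nat.card_congr e, Nat.card_eq_fintype_card, Fintype.card_coe]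
  rw [this, Finset.card_product, card_piAntidiag_univ, card_piAntidiag_univ, card_sigma_fin,
    Fintype.card_fin]

lemma bL_le_bInf (N j m l : ℕ) : bL N j m l ≤ bInf N j m := by
  rw [bL_eq, bInf_eq, arrayFinset]
  refine (Finset.card_filter_le _ _).trans_eq ?_
  rw [Finset.card_product, card_piAntidiag_univ, card_piAntidiag_univ, card_sigma_fin,
    Fintype.card_fin]

lemma pRatio_nonneg (N j m l : ℕ) : 0 ≤ pRatio N j m l := by
  unfold pRatio; positivity

lemma pRatio_le_one (N j m l : ℕ) : pRatio N j m l ≤ 1 :=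
  div_le_one_of_le₀ (by exact_mod_cast bL_le_bInf N j m l) (by positivity)

lemma bInf_mul_pRatio (N j m l : ℕ) : (bInf N j m : ℝ) * pRatio N j m l = bL N j m l := by
  rcases eq_or_ne (bInf N j m) 0 with h | h
  · have := bL_le_bInf N j m l
    rw [h, Nat.le_zero] at this
    simp [h, this]
  · exact mul_div_cancel₀ _ (by exact_mod_cast h)

lemma multichoose_pos_of_succ {n j : ℕ} (h : 0 < n.multichoose (j + 1)) :
    0 < n.multichoose j := by
  have := succ_mul_multichoose_succ n j
  by_contra h0
  rw [show n.multichoose j = 0 by omega, mul_zero] at this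
  have := Nat.mul_pos (show 0 < j + 1 by omega) h
  omega

lemma arrayFinset_succ_left (N j m l : ℕ) :
    (arrayFinset N (j + 1) m l).card * (N * (N - 1) / 2).multichoose j ≤
      (arrayFinset N j m l).card * (N * (N - 1) / 2).multichoose (j + 1) := by
  have h : ∀ j, (arrayFinset N j m l).card =
      ∑ a ∈ Finset.piAntidiag Finset.univ m, ((Finset.piAntidiag Finset.univ j).filter
        fun b => ¬ HasChain (symmArray (N := N) (a, b)) N N (l + 1)).card := by
    intro j
    simp only [arrayFinset, Finset.card_filter, Finset.sum_product]
  rw [h, h, Finset.sum_mul, Finset.sum_mul]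
  refine Finset.sum_le_sum fun a _ => ?_
  rw [← card_sigma_fin]
  exact card_piAntidiag_cross_le
    (fun b b' hb h1 h2 => h1 (h2.mono (symmArray_mono (x := (a, b)) (y := (a, b')) ⟨le_rfl, hb⟩))) j

lemma arrayFinset_succ_right (N j m l : ℕ) :
    (arrayFinset N j (m + 1) l).card * N.multichoose m ≤
      (arrayFinset N j m l).card * N.multichoose (m + 1) := by
  have h : ∀ m, (arrayFinset N j m l).card =
      ∑ b ∈ Finset.piAntidiag Finset.univ j, ((Finset.piAntidiag Finset.univ m).filter
        fun a => ¬ HasChain (symmArray (N := N) (a, b)) N N (l + 1)).card := by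
    intro m
    simp only [arrayFinset, Finset.card_filter, Finset.sum_product_right]
  rw [h, h, Finset.sum_mul, Finset.sum_mul]
  refine Finset.sum_le_sum fun b _ => ?_
  have := card_piAntidiag_cross_le (κ := Fin N)
    (S := fun a => ¬ HasChain (symmArray (N := N) (a, b)) N N (l + 1))
    (fun a a' ha h1 h2 => h1 (h2.mono (symmArray_mono (x := (a, b)) (y := (a', b)) ⟨ha, le_rfl⟩))) m
  rwa [Fintype.card_fin] at this

lemma pRatio_antitone (N l : ℕ) {j j' m m' : ℕ} (hj : j ≤ j') (hm : m ≤ m') :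
    pRatio N j' m' l ≤ pRatio N j m l := by
  have h1 : ∀ m, Antitone fun j => pRatio N j m l := by
    refine fun m => antitone_nat_of_succ_le fun j => ?_
    simp only [pRatio, bL_eq, bInf_eq]
    rcases Nat.eq_zero_or_pos ((N * (N - 1) / 2).multichoose (j + 1)) with h | h
    · simp only [h, mul_zero, Nat.cast_zero, div_zero]
      positivity
    rcases Nat.eq_zero_or_pos (N.multichoose m) with hm | hm
    · simp [hm]
    have h' := multichoose_pos_of_succ h
    rw [div_le_div_iff₀ (by exact_mod_cast Nat.mul_pos hm h)
      (by exact_mod_cast Nat.mul_pos hm h')]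
    have := Nat.mul_le_mul_left (N.multichoose m) (arrayFinset_succ_left N j m l)
    rw [mul_left_comm, mul_left_comm (N.multichoose m)] at this
    exact_mod_cast this
  have h2 : ∀ j, Antitone fun m => pRatio N j m l := by
    refine fun j => antitone_nat_of_succ_le fun m => ?_
    simp only [pRatio, bL_eq, bInf_eq]
    rcases Nat.eq_zero_or_pos (N.multichoose (m + 1)) with h | h
    · simp only [h, zero_mul, Nat.cast_zero, div_zero]
      positivity
    rcases Nat.eq_zero_or_pos ((N * (N - 1) / 2).multichoose j) with hm | hm
    · simp [hm]
    have h' := multichoose_pos_of_succ h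
    rw [div_le_div_iff₀ (by exact_mod_cast Nat.mul_pos h hm)
      (by exact_mod_cast Nat.mul_pos h' hm)]
    have := Nat.mul_le_mul_right ((N * (N - 1) / 2).multichoose j)
      (arrayFinset_succ_right N j m l)
    rw [mul_assoc, mul_assoc] at this
    exact_mod_cast this
  exact (h1 m' hj).trans (h2 j hm)

end Ratio

section Series

/-- The probability weights of the negative binomial distribution. -/
def negBinomial (n : ℕ) (q : ℝ) (j : ℕ) : ℝ := (1 - q) ^ n * (n.multichoose j * q ^ j)

lemma hasSum_multichoose_mul_pow (n : ℕ) {q : ℝ} (hq : |q| < 1) :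
    HasSum (fun j => (n.multichoose j : ℝ) * q ^ j) (1 / (1 - q) ^ n) := by
  rcases n with _ | n
  · have := hasSum_single (f := fun j => ((Nat.multichoose 0 j : ℕ) : ℝ) * q ^ j) 0
      (fun j hj => by obtain ⟨j, rfl⟩ := Nat.exists_eq_succ_of_ne_zero hj; simp)
    simpa using this
  · have := hasSum_choose_mul_geometric_of_norm_lt_one n (r := q) (by simpa using hq)
    refine this.congr_fun fun j => ?_
    rw [Nat.multichoose_eq, show n + 1 + j - 1 = j + n by omega, Nat.choose_symm_add]

lemma negBinomial_nonneg (n : ℕ) {q : ℝ} (hq : 0 ≤ q) (hq1 : q < 1) (j : ℕ) :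
    0 ≤ negBinomial n q j := by
  have : 0 < 1 - q := by linarith
  unfold negBinomial; positivity

/-- The moment generating function of the negative binomial distribution. -/
lemma hasSum_negBinomial_mul_pow (n : ℕ) {q s : ℝ} (hs : |q * s| < 1) :
    HasSum (fun j => negBinomial n q j * s ^ j) (((1 - q) / (1 - q * s)) ^ n) := by
  have := (hasSum_multichoose_mul_pow n hs).mul_left ((1 - q) ^ n)
  rw [div_pow, ← mul_one_div]
  refine this.congr_fun fun j => ?_
  rw [negBinomial, mul_pow]
  ring

lemma hasSum_negBinomial (n : ℕ) {q : ℝ} (hq : 0 ≤ q) (hq1 : q < 1) :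
    HasSum (negBinomial n q) 1 := by
  have := hasSum_negBinomial_mul_pow n (q := q) (s := 1) (by rw [mul_one, abs_of_nonneg hq]; exact hq1)
  have h : 1 - q ≠ 0 := by linarith
  simpa [h] using this

lemma ENNReal.tsum_comp_eq_tsum_card {α γ : Type*} (f : α → γ) (g : γ → ENNReal)
    (hf : ∀ c, Finite {a // f a = c}) :
    ∑' a, g (f a) = ∑' c, (Nat.card {a // f a = c} : ENNReal) * g c := by
  rw [← (Equiv.sigmaFiberEquiv f).tsum_eq, ENNReal.tsum_sigma']
  refine tsum_congr fun c => ?_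
  have := Fintype.ofFinite {a // f a = c}
  rw [tsum_fintype, Finset.sum_congr rfl fun x _ => by
    rw [show g (f (Equiv.sigmaFiberEquiv f ⟨c, x⟩)) = g c from congrArg g x.2],
    Finset.sum_const, nsmul_eq_mul, Finset.card_univ, Nat.card_eq_fintype_card]


lemma card_eq_two_mul_add_oddCols {N : ℕ} (τ : Σ μ, SSYTN N μ) :
    τ.1.card = 2 * ((τ.1.card - oddCols τ.1) / 2) + oddCols τ.1 := by
  obtain ⟨e, he⟩ := exists_tableau_equiv N
  have h1 := card_eq_of_growth (he τ)
  have h2 := oddCols_eq_of_growth (he τ)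
  omega

lemma finite_SSYTN (N : ℕ) (μ : YoungDiagram) : Finite (SSYTN N μ) := by
  rcases isEmpty_or_nonempty (SSYTN N μ) with h | ⟨⟨T₀⟩⟩
  · infer_instance
  obtain ⟨e⟩ := nonempty_equiv_arrayFinset N ((μ.card - oddCols μ) / 2) (oddCols μ) (numRows μ)
  have := Finite.of_equiv _ e.symm
  refine Finite.of_injective (β := Σ μ' : {μ' : YoungDiagram //
    μ'.card = 2 * ((μ.card - oddCols μ) / 2) + oddCols μ ∧ oddCols μ' = oddCols μ ∧
      numRows μ' ≤ numRows μ}, SSYTN N μ'.1)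
    (fun T => ⟨⟨μ, card_eq_two_mul_add_oddCols ⟨μ, T₀⟩, rfl, le_rfl⟩, T⟩) fun T T' h => ?_
  simpa using h

/-- The tableaux with at most `l` rows and prescribed statistics. -/
def fiberEquiv (N l : ℕ) (p : ℕ × ℕ) :
    {σ : Σ μ : {μ : YoungDiagram // numRows μ ≤ l}, SSYTN N μ.1 //
      ((σ.1.1.card - oddCols σ.1.1) / 2, oddCols σ.1.1) = p} ≃
    Σ μ : {μ : YoungDiagram //
      μ.card = 2 * p.1 + p.2 ∧ oddCols μ = p.2 ∧ numRows μ ≤ l}, SSYTN N μ.1 where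
  toFun σ := ⟨⟨σ.1.1.1, by
    have h1 := card_eq_two_mul_add_oddCols ⟨σ.1.1.1, σ.1.2⟩
    have h2 := congrArg Prod.fst σ.2
    have h3 := congrArg Prod.snd σ.2
    dsimp only at h1 h2 h3
    omega, congrArg Prod.snd σ.2, σ.1.1.2⟩, σ.1.2⟩
  invFun σ := ⟨⟨⟨σ.1.1, σ.1.2.2.2⟩, σ.2⟩, by
    have h1 := σ.1.2.1
    have h2 := σ.1.2.2.1
    refine Prod.ext ?_ h2
    dsimp only
    omega⟩
  left_inv _ := rfl
  right_inv _ := rfl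

lemma tsum_tableaux (N l : ℕ) {t β : ℝ} (ht : 0 < t) (hβ : 0 < β) :
    ∑' μ : {μ : YoungDiagram // numRows μ ≤ l},
      ENNReal.ofReal (t ^ (μ.1.card) * β ^ (oddCols μ.1) * (dCount N μ.1 : ℝ)) =
    ∑' p : ℕ × ℕ, ENNReal.ofReal (bL N p.1 p.2 l * ((t ^ 2) ^ p.1 * (β * t) ^ p.2)) := by
  have hfib : ∀ p, Finite {σ : Σ μ : {μ : YoungDiagram // numRows μ ≤ l}, SSYTN N μ.1 //
      ((σ.1.1.card - oddCols σ.1.1) / 2, oddCols σ.1.1) = p} := by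
    intro p
    obtain ⟨e⟩ := nonempty_equiv_arrayFinset N p.1 p.2 l
    exact Finite.of_equiv _ ((fiberEquiv N l p).trans e).symm
  have key := ENNReal.tsum_comp_eq_tsum_card
    (fun σ : Σ μ : {μ : YoungDiagram // numRows μ ≤ l}, SSYTN N μ.1 =>
      ((σ.1.1.card - oddCols σ.1.1) / 2, oddCols σ.1.1))
    (fun p => ENNReal.ofReal ((t ^ 2) ^ p.1 * (β * t) ^ p.2)) hfib
  simp only [fun p => Nat.card_congr (fiberEquiv N l p)] at key
  rw [ENNReal.tsum_sigma'] at key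
  refine Eq.trans ?_ (key.trans ?_)
  · refine tsum_congr fun μ => ?_
    have hfin := finite_SSYTN N μ.1
    have := Fintype.ofFinite (SSYTN N μ.1)
    have h : ∀ T : SSYTN N μ.1,
        ENNReal.ofReal ((t ^ 2) ^ ((μ.1.card - oddCols μ.1) / 2) * (β * t) ^ oddCols μ.1) =
          ENNReal.ofReal (t ^ μ.1.card * β ^ oddCols μ.1) := by
      intro T
      have := card_eq_two_mul_add_oddCols ⟨μ.1, T⟩
      dsimp only at this
      congr 1
      conv_rhs => rw [this, pow_add, pow_mul]
      rw [mul_pow]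
      ring
    rw [tsum_congr h, tsum_fintype, Finset.sum_const, nsmul_eq_mul, Finset.card_univ, dCount,
      Nat.card_eq_fintype_card, mul_comm, ENNReal.ofReal_mul' (by positivity),
      ENNReal.ofReal_natCast, mul_comm]
  · refine tsum_congr fun p => ?_
    rw [ENNReal.ofReal_mul (Nat.cast_nonneg _), ENNReal.ofReal_natCast, bL]

/-- `φ` is the average of the ratios `p(N, j, m, l)` over independent negative binomial
variables `j` and `m`. -/
lemma hasSum_phiGF (N l : ℕ) {t β : ℝ} (ht : 0 < t) (ht1 : t < 1) (hβ : 0 < β)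
    (hβt : β * t < 1) :
    HasSum (fun p : ℕ × ℕ => negBinomial (N * (N - 1) / 2) (t ^ 2) p.1 *
      negBinomial N (β * t) p.2 * pRatio N p.1 p.2 l) (phiGF N l t β) := by
  have ht2 : t ^ 2 < 1 := by nlinarith
  have hw : Summable fun p : ℕ × ℕ => negBinomial (N * (N - 1) / 2) (t ^ 2) p.1 *
      negBinomial N (β * t) p.2 :=
    (hasSum_negBinomial _ (by positivity) ht2).summable.mul_of_nonneg
      (hasSum_negBinomial _ (by positivity) hβt).summable
      (negBinomial_nonneg _ (by positivity) ht2) (negBinomial_nonneg _ (by positivity) hβt)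
  have hsum : Summable fun p : ℕ × ℕ => negBinomial (N * (N - 1) / 2) (t ^ 2) p.1 *
      negBinomial N (β * t) p.2 * pRatio N p.1 p.2 l := by
    refine Summable.of_nonneg_of_le (fun p => ?_) (fun p => ?_) hw
    · exact mul_nonneg (mul_nonneg (negBinomial_nonneg _ (by positivity) ht2 _)
        (negBinomial_nonneg _ (by positivity) hβt _)) (pRatio_nonneg _ _ _ _)
    · exact mul_le_of_le_one_right (mul_nonneg (negBinomial_nonneg _ (by positivity) ht2 _)
        (negBinomial_nonneg _ (by positivity) hβt _)) (pRatio_le_one _ _ _ _)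
  have hterm : ∀ p : ℕ × ℕ, negBinomial (N * (N - 1) / 2) (t ^ 2) p.1 *
      negBinomial N (β * t) p.2 * pRatio N p.1 p.2 l =
      (1 - t ^ 2) ^ (N * (N - 1) / 2) * (1 - β * t) ^ N *
        (bL N p.1 p.2 l * ((t ^ 2) ^ p.1 * (β * t) ^ p.2)) := by
    intro p
    rw [← bInf_mul_pRatio, bInf_eq, negBinomial, negBinomial]
    push_cast
    ring
  have hc : (1 - t ^ 2) ^ (N * (N - 1) / 2) * (1 - β * t) ^ N ≠ 0 := by
    have h1 : 0 < 1 - t ^ 2 := by linarith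
    have h2 : 0 < 1 - β * t := by linarith
    positivity
  have hsum' := hsum
  simp only [hterm] at hsum' ⊢
  rw [summable_mul_left_iff hc] at hsum'
  have h := tsum_tableaux N l ht hβ
  rw [← ENNReal.ofReal_tsum_of_nonneg (fun p => by positivity) hsum'] at h
  have h2 := congrArg ENNReal.toReal h
  rw [ENNReal.tsum_toReal_eq fun _ => ENNReal.ofReal_ne_top,
    ENNReal.toReal_ofReal (tsum_nonneg fun p => by positivity)] at h2
  rw [phiGF]
  have h3 : ∀ μ : {μ : YoungDiagram // numRows μ ≤ l},
      (ENNReal.ofReal (t ^ (μ.1.card) * β ^ (oddCols μ.1) * (dCount N μ.1 : ℝ))).toReal =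
      t ^ (μ.1.card) * β ^ (oddCols μ.1) * (dCount N μ.1 : ℝ) :=
    fun μ => ENNReal.toReal_ofReal (by positivity)
  rw [tsum_congr h3] at h2
  rw [h2]
  exact hsum'.hasSum.mul_left _

end Series

section Concentration

lemma one_le_one_sub_mul_exp {u : ℝ} (hu : |u| ≤ 1 / 2) : 1 ≤ (1 - u) * Real.exp (u + u ^ 2) := by
  obtain ⟨h1, h2⟩ := abs_le.1 hu
  rcases le_total u 0 with h | h
  · have h3 := Real.add_one_le_exp (u + u ^ 2)
    have h4 : (1 - u) * (u + u ^ 2 + 1) ≤ (1 - u) * Real.exp (u + u ^ 2) :=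
      mul_le_mul_of_nonneg_left h3 (by linarith)
    nlinarith [mul_nonneg (sq_nonneg u) (neg_nonneg.2 h)]
  · have h3 := Real.quadratic_le_exp_of_nonneg (x := u + u ^ 2) (by positivity)
    have h4 := mul_le_mul_of_nonneg_left h3 (show (0 : ℝ) ≤ 1 - u by linarith)
    have h5 : 0 ≤ 1 - u - u ^ 2 - u ^ 3 := by nlinarith [mul_nonneg h h]
    nlinarith [mul_nonneg (sq_nonneg u) h5]

/-- The cumulant generating function of a geometric variable is bounded by a quadratic. -/
lemma geometric_mgf_le {q r θ : ℝ} (hq : 0 ≤ q) (hq1 : q < 1) (hr : r = q / (1 - q))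
    (hθ : |θ| * (4 * (r + 1)) ≤ 1) :
    q * Real.exp θ < 1 ∧
      (1 - q) / (1 - q * Real.exp θ) ≤ Real.exp (r * θ + (r + 4 * r ^ 2) * θ ^ 2) := by
  have hq' : 0 < 1 - q := by linarith
  have hr0 : 0 ≤ r := by rw [hr]; positivity
  have hθ0 := abs_nonneg θ
  have hθ1 : |θ| ≤ 1 := by nlinarith
  have he1 : |Real.exp θ - 1| ≤ 2 * |θ| := Real.abs_exp_sub_one_le hθ1
  have he2 : Real.exp θ - 1 - θ ≤ θ ^ 2 :=
    (le_abs_self _).trans (Real.abs_exp_sub_one_sub_id_le hθ1)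
  set u := r * (Real.exp θ - 1) with hu
  have hfac : 1 - q * Real.exp θ = (1 - q) * (1 - u) := by
    rw [hu, hr]; field_simp; ring
  have hu1 : |u| ≤ 2 * r * |θ| := by
    rw [hu, abs_mul, abs_of_nonneg hr0]
    nlinarith
  have hu2 : |u| ≤ 1 / 2 := by nlinarith
  have hu3 : 0 < 1 - u := by linarith [(abs_le.1 hu2).2]
  have hu4 : u ^ 2 ≤ 4 * r ^ 2 * θ ^ 2 := by
    rw [← sq_abs u, ← sq_abs θ]
    nlinarith [abs_nonneg u]
  refine ⟨by nlinarith [mul_pos hq' hu3], ?_⟩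
  rw [hfac, div_mul_eq_div_div, div_self hq'.ne', div_le_iff₀ hu3]
  have h1 := one_le_one_sub_mul_exp hu2
  have h2 : u + u ^ 2 ≤ r * θ + (r + 4 * r ^ 2) * θ ^ 2 := by nlinarith
  have h3 := mul_le_mul_of_nonneg_left (Real.exp_le_exp.2 h2) hu3.le
  linarith

lemma exists_hasSum_negBinomial_mul_exp (n : ℕ) {q r θ : ℝ} (hq : 0 ≤ q) (hq1 : q < 1)
    (hr : r = q / (1 - q)) (hθ : |θ| * (4 * (r + 1)) ≤ 1) :
    ∃ G ≤ Real.exp (n * (r * θ + (r + 4 * r ^ 2) * θ ^ 2)),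
      HasSum (fun j => negBinomial n q j * Real.exp (θ * j)) G := by
  obtain ⟨h1, h2⟩ := geometric_mgf_le hq hq1 hr hθ
  refine ⟨_, ?_, ((hasSum_negBinomial_mul_pow n (q := q) (s := Real.exp θ)
    (by rwa [abs_of_nonneg (by positivity)])).congr_fun fun j => ?_)⟩
  · rw [Real.exp_nat_mul]
    exact pow_le_pow_left₀ (div_nonneg (by linarith) (by linarith)) h2 n
  · rw [← Real.exp_nat_mul, mul_comm θ]

/-- An average over two independent variables is controlled by exponential moments. -/
lemma average_le {v w : ℕ → ℝ} (hv : ∀ j, 0 ≤ v j) (hw : ∀ m, 0 ≤ w m) (hv1 : HasSum v 1)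
    (hw1 : HasSum w 1) {θ η G H c A B s : ℝ}
    (hG : HasSum (fun j => v j * Real.exp (θ * j)) G)
    (hH : HasSum (fun m => w m * Real.exp (η * m)) H) {f : ℕ → ℕ → ℝ}
    (hf : HasSum (fun p : ℕ × ℕ => v p.1 * w p.2 * f p.1 p.2) s)
    (h : ∀ j m, f j m ≤ c + A * Real.exp (θ * j) + B * Real.exp (η * m)) :
    s ≤ c + A * G + B * H := by
  have hprod : ∀ {a b : ℕ → ℝ} {x y : ℝ}, (∀ j, 0 ≤ a j) → (∀ j, 0 ≤ b j) → HasSum a x →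
      HasSum b y → HasSum (fun p : ℕ × ℕ => a p.1 * b p.2) (x * y) := by
    intro a b x y ha hb hx hy
    exact hx.mul hy (hx.summable.mul_of_nonneg hy.summable ha hb)
  have hG0 : ∀ j : ℕ, 0 ≤ v j * Real.exp (θ * j) :=
    fun j => mul_nonneg (hv j) (Real.exp_pos _).le
  have hH0 : ∀ m : ℕ, 0 ≤ w m * Real.exp (η * m) :=
    fun m => mul_nonneg (hw m) (Real.exp_pos _).le
  have hsum := (((hprod hv hw hv1 hw1).mul_left c).add
    ((hprod hG0 hw hG hw1).mul_left A)).add ((hprod hv hH0 hv1 hH).mul_left B)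
  refine (hasSum_le (fun p => ?_) hf hsum).trans_eq (by ring)
  have := mul_le_mul_of_nonneg_left (h p.1 p.2) (mul_nonneg (hv p.1) (hw p.2))
  refine this.trans_eq ?_
  ring

section Bounds

variable {t β r₁ r₂ θ₁ θ₂ : ℝ} (ht : 0 < t) (ht1 : t < 1) (hβ : 0 < β) (hβt : β * t < 1)
  (hr₁ : r₁ = t ^ 2 / (1 - t ^ 2)) (hr₂ : r₂ = β * t / (1 - β * t))
  (hθ₁ : 0 ≤ θ₁) (hθ₂ : 0 ≤ θ₂) (hθ₁' : θ₁ * (4 * (r₁ + 1)) ≤ 1)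
  (hθ₂' : θ₂ * (4 * (r₂ + 1)) ≤ 1)

include ht ht1 hβ hβt hr₁ hr₂ hθ₁ hθ₂ hθ₁' hθ₂'

lemma phiGF_le_pRatio_add (N l : ℕ) (y₁ y₂ : ℝ) :
    phiGF N l t β ≤ pRatio N ⌊y₁⌋₊ ⌊y₂⌋₊ l +
      Real.exp (θ₁ * y₁ + ((N * (N - 1) / 2 : ℕ) : ℝ) *
        (r₁ * (-θ₁) + (r₁ + 4 * r₁ ^ 2) * (-θ₁) ^ 2)) +
      Real.exp (θ₂ * y₂ + (N : ℝ) * (r₂ * (-θ₂) + (r₂ + 4 * r₂ ^ 2) * (-θ₂) ^ 2)) := by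
  have ht2 : t ^ 2 < 1 := by nlinarith
  have ht0 : 0 ≤ t ^ 2 := by positivity
  have hβ0 : 0 ≤ β * t := by positivity
  obtain ⟨G, hG, hG'⟩ := exists_hasSum_negBinomial_mul_exp (N * (N - 1) / 2) ht0 ht2 hr₁
    (θ := -θ₁) (by rwa [abs_neg, abs_of_nonneg hθ₁])
  obtain ⟨H, hH, hH'⟩ := exists_hasSum_negBinomial_mul_exp N hβ0 hβt hr₂
    (θ := -θ₂) (by rwa [abs_neg, abs_of_nonneg hθ₂])
  have key := average_le (v := negBinomial (N * (N - 1) / 2) (t ^ 2)) (w := negBinomial N (β * t))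
    (negBinomial_nonneg _ ht0 ht2) (negBinomial_nonneg _ hβ0 hβt)
    (hasSum_negBinomial _ ht0 ht2) (hasSum_negBinomial _ hβ0 hβt) hG' hH'
    (f := fun j m => pRatio N j m l) (hasSum_phiGF N l ht ht1 hβ hβt) (c := pRatio N ⌊y₁⌋₊ ⌊y₂⌋₊ l)
    (A := Real.exp (θ₁ * y₁)) (B := Real.exp (θ₂ * y₂)) (fun j m => ?_)
  · rw [Real.exp_add, Real.exp_add]
    have h1 := mul_le_mul_of_nonneg_left hG (Real.exp_pos (θ₁ * y₁)).le
    have h2 := mul_le_mul_of_nonneg_left hH (Real.exp_pos (θ₂ * y₂)).le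
    linarith
  · rw [← Real.exp_add, ← Real.exp_add]
    have hp := pRatio_nonneg N ⌊y₁⌋₊ ⌊y₂⌋₊ l
    have hp1 := pRatio_le_one N j m l
    rcases lt_or_ge j ⌊y₁⌋₊ with hj | hj
    · have h := (Nat.lt_of_lt_floor hj).le
      have : 1 ≤ Real.exp (θ₁ * y₁ + -θ₁ * j) := Real.one_le_exp (by nlinarith)
      linarith [Real.exp_pos (θ₂ * y₂ + -θ₂ * m)]
    rcases lt_or_ge m ⌊y₂⌋₊ with hm | hm
    · have h := (Nat.lt_of_lt_floor hm).le
      have : 1 ≤ Real.exp (θ₂ * y₂ + -θ₂ * m) := Real.one_le_exp (by nlinarith)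
      linarith [Real.exp_pos (θ₁ * y₁ + -θ₁ * j)]
    linarith [pRatio_antitone N l hj hm, Real.exp_pos (θ₂ * y₂ + -θ₂ * m),
      Real.exp_pos (θ₁ * y₁ + -θ₁ * j)]

lemma pRatio_sub_le_phiGF (N l : ℕ) (y₁ y₂ : ℝ) :
    pRatio N ⌊y₁⌋₊ ⌊y₂⌋₊ l ≤ phiGF N l t β +
      Real.exp (-θ₁ * y₁ + ((N * (N - 1) / 2 : ℕ) : ℝ) *
        (r₁ * θ₁ + (r₁ + 4 * r₁ ^ 2) * θ₁ ^ 2)) +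
      Real.exp (-θ₂ * y₂ + (N : ℝ) * (r₂ * θ₂ + (r₂ + 4 * r₂ ^ 2) * θ₂ ^ 2)) := by
  have ht2 : t ^ 2 < 1 := by nlinarith
  have ht0 : 0 ≤ t ^ 2 := by positivity
  have hβ0 : 0 ≤ β * t := by positivity
  obtain ⟨G, hG, hG'⟩ := exists_hasSum_negBinomial_mul_exp (N * (N - 1) / 2) ht0 ht2 hr₁
    (θ := θ₁) (by rwa [abs_of_nonneg hθ₁])
  obtain ⟨H, hH, hH'⟩ := exists_hasSum_negBinomial_mul_exp N hβ0 hβt hr₂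
    (θ := θ₂) (by rwa [abs_of_nonneg hθ₂])
  have key := average_le (v := negBinomial (N * (N - 1) / 2) (t ^ 2)) (w := negBinomial N (β * t))
    (negBinomial_nonneg _ ht0 ht2) (negBinomial_nonneg _ hβ0 hβt)
    (hasSum_negBinomial _ ht0 ht2) (hasSum_negBinomial _ hβ0 hβt) hG' hH'
    (f := fun j m => -pRatio N j m l)
    ((hasSum_phiGF N l ht ht1 hβ hβt).neg.congr_fun fun p => by ring)
    (c := -pRatio N ⌊y₁⌋₊ ⌊y₂⌋₊ l)
    (A := Real.exp (-θ₁ * y₁)) (B := Real.exp (-θ₂ * y₂)) (fun j m => ?_)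
  · rw [Real.exp_add, Real.exp_add]
    have h1 := mul_le_mul_of_nonneg_left hG (Real.exp_pos (-θ₁ * y₁)).le
    have h2 := mul_le_mul_of_nonneg_left hH (Real.exp_pos (-θ₂ * y₂)).le
    linarith
  · rw [← Real.exp_add, ← Real.exp_add]
    have hp := pRatio_nonneg N j m l
    have hp1 := pRatio_le_one N ⌊y₁⌋₊ ⌊y₂⌋₊ l
    rcases lt_or_ge ⌊y₁⌋₊ j with hj | hj
    · have h := (Nat.lt_of_floor_lt hj).le
      have : 1 ≤ Real.exp (-θ₁ * y₁ + θ₁ * j) := Real.one_le_exp (by nlinarith)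
      linarith [Real.exp_pos (-θ₂ * y₂ + θ₂ * m)]
    rcases lt_or_ge ⌊y₂⌋₊ m with hm | hm
    · have h := (Nat.lt_of_floor_lt hm).le
      have : 1 ≤ Real.exp (-θ₂ * y₂ + θ₂ * m) := Real.one_le_exp (by nlinarith)
      linarith [Real.exp_pos (-θ₁ * y₁ + θ₁ * j)]
    linarith [pRatio_antitone N l hj hm, Real.exp_pos (-θ₂ * y₂ + θ₂ * m),
      Real.exp_pos (-θ₁ * y₁ + θ₁ * j)]

end Bounds

lemma phiGF_mem_Icc (N l : ℕ) {t β : ℝ} (ht : 0 < t) (ht1 : t < 1) (hβ : 0 < β)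
    (hβt : β * t < 1) : 0 ≤ phiGF N l t β ∧ phiGF N l t β ≤ 1 := by
  have ht2 : t ^ 2 < 1 := by nlinarith
  have ht0 : 0 ≤ t ^ 2 := by positivity
  have hβ0 : 0 ≤ β * t := by positivity
  have h := hasSum_phiGF N l ht ht1 hβ hβt
  have hG := hasSum_negBinomial (N * (N - 1) / 2) ht0 ht2
  have hH := hasSum_negBinomial N hβ0 hβt
  constructor
  · exact h.nonneg fun p => mul_nonneg (mul_nonneg (negBinomial_nonneg _ ht0 ht2 _)
      (negBinomial_nonneg _ hβ0 hβt _)) (pRatio_nonneg _ _ _ _)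
  · have := average_le (v := negBinomial (N * (N - 1) / 2) (t ^ 2)) (w := negBinomial N (β * t))
      (negBinomial_nonneg _ ht0 ht2) (negBinomial_nonneg _ hβ0 hβt) hG hH
      (θ := 0) (η := 0) (by simpa using hG) (by simpa using hH)
      (f := fun j m => pRatio N j m l) h (c := 1) (A := 0) (B := 0)
      (fun j m => by simpa using pRatio_le_one N j m l)
    simpa using this

end Concentration
/-- De-Poissonization: `p(N, μ₊(N), ν₊(N), l) - C₀ N^{-d} ≤ φ(N,l,t,β)
  ≤ p(N, μ₋(N), ν₋(N), l) + C₀ N^{-d}`. -/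
theorem phi_pRatio_bounds (t β : ℝ) (ht : 0 < t) (ht1 : t < 1)
    (hβ : 0 < β) (hβt : β * t < 1) :
    ∀ d : ℝ, 0 < d → ∃ C₀ > (0 : ℝ), ∃ c₀ > (0 : ℝ), ∀ N : ℕ, 0 < N → ∀ l : ℕ,
      pRatio N ⌊t ^ 2 * (N : ℝ) ^ 2 / (2 * (1 - t ^ 2)) +
            c₀ * (N : ℝ) * Real.sqrt (Real.log N)⌋₊
          ⌊β * t * (N : ℝ) / (1 - β * t) + c₀ * Real.sqrt ((N : ℝ) * Real.log N)⌋₊ l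
        - C₀ * (N : ℝ) ^ (-d) ≤ phiGF N l t β ∧
      phiGF N l t β ≤
        pRatio N ⌊t ^ 2 * (N : ℝ) ^ 2 / (2 * (1 - t ^ 2)) -
              c₀ * (N : ℝ) * Real.sqrt (Real.log N)⌋₊
            ⌊β * t * (N : ℝ) / (1 - β * t) - c₀ * Real.sqrt ((N : ℝ) * Real.log N)⌋₊ l
          + C₀ * (N : ℝ) ^ (-d) := by
  intro d hd
  have ht2 : 0 < 1 - t ^ 2 := by nlinarith
  have hb2 : 0 < 1 - β * t := by linarith
  obtain ⟨r₁, hr₁⟩ : ∃ r, r = t ^ 2 / (1 - t ^ 2) := ⟨_, rfl⟩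
  obtain ⟨r₂, hr₂⟩ : ∃ r, r = β * t / (1 - β * t) := ⟨_, rfl⟩
  have hr₁0 : 0 ≤ r₁ := by rw [hr₁]; positivity
  have hr₂0 : 0 ≤ r₂ := by rw [hr₂]; positivity
  obtain ⟨δ, hδ⟩ : ∃ δ, δ = 1 / (4 * (r₁ + r₂ + 1)) := ⟨_, rfl⟩
  have hδ0 : 0 < δ := by rw [hδ]; positivity
  have hδ1 : δ * (4 * (r₁ + r₂ + 1)) = 1 := by rw [hδ]; field_simp
  obtain ⟨σ₁, hσ₁⟩ : ∃ σ, σ = r₁ + 4 * r₁ ^ 2 := ⟨_, rfl⟩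
  obtain ⟨σ₂, hσ₂⟩ : ∃ σ, σ = r₂ + 4 * r₂ ^ 2 := ⟨_, rfl⟩
  have hσ₁0 : 0 ≤ σ₁ := by rw [hσ₁]; positivity
  have hσ₂0 : 0 ≤ σ₂ := by rw [hσ₂]; positivity
  obtain ⟨c, hc⟩ : ∃ c, c = (d + δ * r₁ + (σ₁ + σ₂) * δ ^ 2) / δ := ⟨_, rfl⟩
  have hc0 : 0 < c := by rw [hc]; positivity
  have hδc : δ * c = d + δ * r₁ + (σ₁ + σ₂) * δ ^ 2 := by rw [hc]; field_simp
  refine ⟨2, two_pos, c, hc0, fun N hN l => ?_⟩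
  rcases (show N = 1 ∨ 2 ≤ N by omega) with rfl | hN2
  · obtain ⟨h0, h1⟩ := phiGF_mem_Icc 1 l ht ht1 hβ hβt
    rw [Nat.cast_one, Real.one_rpow]
    constructor
    · refine (sub_le_sub_right (pRatio_le_one _ _ _ _) _).trans ?_
      linarith
    · refine h1.trans ?_
      exact le_add_of_nonneg_of_le (pRatio_nonneg _ _ _ _) (by norm_num)
  have hNr : (2 : ℝ) ≤ N := by exact_mod_cast hN2
  have hN0 : (0 : ℝ) < N := by linarith
  have hlog : 1 / 4 ≤ Real.log N := by
    have h1 := Real.log_two_gt_d9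
    have h2 := Real.log_le_log two_pos hNr
    linarith
  have hlogN : Real.log N ≤ N := Real.log_le_self hN0.le
  obtain ⟨S, hS⟩ : ∃ S, S = Real.sqrt (Real.log N) := ⟨_, rfl⟩
  obtain ⟨R, hR⟩ : ∃ R, R = Real.sqrt N := ⟨_, rfl⟩
  have hSsq : S ^ 2 = Real.log N := by rw [hS]; exact Real.sq_sqrt (by linarith)
  have hRsq : R ^ 2 = N := by rw [hR]; exact Real.sq_sqrt hN0.le
  have hS0 : 1 / 2 ≤ S := by rw [hS]; exact Real.le_sqrt_of_sq_le (by linarith)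
  have hR0 : 0 < R := by rw [hR]; exact Real.sqrt_pos.2 hN0
  have hSR : S ≤ R := by rw [hS, hR]; exact Real.sqrt_le_sqrt hlogN
  have hR1 : 1 ≤ R := by rw [hR]; exact Real.one_le_sqrt.2 (by linarith only [hNr])
  have hSN : S ≤ N := by
    rw [← hRsq, sq]
    exact hSR.trans (le_mul_of_one_le_left hR0.le hR1)
  have hsqrt : Real.sqrt (N * Real.log N) = R * S := by
    rw [hS, hR, Real.sqrt_mul hN0.le]
  have hK : (((N * (N - 1) / 2 : ℕ) : ℝ)) = N * (N - 1) / 2 := by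
    rw [Nat.cast_div (Nat.even_mul_pred_self N).two_dvd (by norm_num), Nat.cast_mul,
      Nat.cast_sub (by omega)]
    simp
  have hcenter : t ^ 2 * (N : ℝ) ^ 2 / (2 * (1 - t ^ 2)) = r₁ * N ^ 2 / 2 := by
    rw [hr₁]; field_simp
  have hcenter' : β * t * (N : ℝ) / (1 - β * t) = r₂ * N := by
    rw [hr₂]; field_simp
  rw [hcenter, hcenter', hsqrt, ← hS]
  obtain ⟨θ₁, hθ₁⟩ : ∃ θ, θ = δ * S / N := ⟨_, rfl⟩
  obtain ⟨θ₂, hθ₂⟩ : ∃ θ, θ = δ * S / R := ⟨_, rfl⟩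
  have hθ₁N : θ₁ * N = δ * S := by rw [hθ₁]; field_simp
  have hθ₂R : θ₂ * R = δ * S := by rw [hθ₂]; field_simp
  have hθ₁0 : 0 ≤ θ₁ := by rw [hθ₁]; positivity
  have hθ₂0 : 0 ≤ θ₂ := by rw [hθ₂]; positivity
  have hθ₁δ : θ₁ ≤ δ := by
    rw [hθ₁, div_le_iff₀ hN0]; exact mul_le_mul_of_nonneg_left hSN hδ0.le
  have hθ₂δ : θ₂ ≤ δ := by
    rw [hθ₂, div_le_iff₀ hR0]; exact mul_le_mul_of_nonneg_left hSR hδ0.le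
  have hθ₁' : θ₁ * (4 * (r₁ + 1)) ≤ 1 := by
    exact hδ1 ▸ mul_le_mul hθ₁δ (by linarith) (by positivity) hδ0.le
  have hθ₂' : θ₂ * (4 * (r₂ + 1)) ≤ 1 := by
    exact hδ1 ▸ mul_le_mul hθ₂δ (by linarith) (by positivity) hδ0.le
  have hpow : (N : ℝ) ^ (-d) = Real.exp (-(d * S ^ 2)) := by
    rw [Real.rpow_def_of_pos hN0, hSsq]; ring_nf
  have hvar₁ : ((N : ℝ) * (N - 1) / 2) * θ₁ ^ 2 ≤ δ ^ 2 * S ^ 2 := by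
    have h1 : 0 ≤ θ₁ ^ 2 * ((N : ℝ) ^ 2 + N) / 2 := by positivity
    rw [← mul_pow, ← hθ₁N]
    linarith
  have hvar₂ : (N : ℝ) * θ₂ ^ 2 = δ ^ 2 * S ^ 2 := by
    rw [← mul_pow, ← hθ₂R, ← hRsq]; ring
  have hSS : S ≤ 2 * S ^ 2 := by
    have := mul_le_mul_of_nonneg_left hS0 (show 0 ≤ S by linarith only [hS0])
    linarith only [this]
  have hexp₂ : -(δ * c * S ^ 2) + σ₂ * (N * θ₂ ^ 2) ≤ -(d * S ^ 2) := by
    rw [hδc, hvar₂]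
    have : 0 ≤ δ * r₁ * S ^ 2 + σ₁ * δ ^ 2 * S ^ 2 := by positivity
    linarith
  have hexp₁ : -(δ * c * S ^ 2) + σ₁ * ((N : ℝ) * (N - 1) / 2 * θ₁ ^ 2) + δ * r₁ * S / 2 ≤
      -(d * S ^ 2) := by
    have h1 := mul_le_mul_of_nonneg_left hvar₁ hσ₁0
    have h2 := mul_le_mul_of_nonneg_left hSS (mul_nonneg hδ0.le hr₁0)
    have : 0 ≤ σ₂ * δ ^ 2 * S ^ 2 := by positivity
    rw [hδc]
    linarith
  have hc₁ : θ₁ * (c * N * S) = δ * c * S ^ 2 := by linear_combination c * S * hθ₁N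
  have hc₂ : θ₂ * (c * (R * S)) = δ * c * S ^ 2 := by linear_combination c * S * hθ₂R
  have hs₁ : θ₁ * r₁ * N / 2 = δ * r₁ * S / 2 := by linear_combination r₁ / 2 * hθ₁N
  have hs₁0 : 0 ≤ δ * r₁ * S / 2 := by positivity
  rw [hpow]
  constructor
  · have h := pRatio_sub_le_phiGF ht ht1 hβ hβt hr₁ hr₂ hθ₁0 hθ₂0 hθ₁' hθ₂' N l
      (r₁ * N ^ 2 / 2 + c * N * S) (r₂ * N + c * (R * S))
    rw [hK, ← hσ₁, ← hσ₂] at h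
    have h1 := Real.exp_le_exp.2 (show -θ₁ * (r₁ * N ^ 2 / 2 + c * N * S) +
      (N : ℝ) * (N - 1) / 2 * (r₁ * θ₁ + σ₁ * θ₁ ^ 2) ≤ -(d * S ^ 2) by linarith)
    have h2 := Real.exp_le_exp.2 (show -θ₂ * (r₂ * N + c * (R * S)) +
      (N : ℝ) * (r₂ * θ₂ + σ₂ * θ₂ ^ 2) ≤ -(d * S ^ 2) by linarith)
    linarith
  · have h := phiGF_le_pRatio_add ht ht1 hβ hβt hr₁ hr₂ hθ₁0 hθ₂0 hθ₁' hθ₂' N l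
      (r₁ * N ^ 2 / 2 - c * N * S) (r₂ * N - c * (R * S))
    rw [hK, ← hσ₁, ← hσ₂] at h
    have h1 := Real.exp_le_exp.2 (show θ₁ * (r₁ * N ^ 2 / 2 - c * N * S) +
      (N : ℝ) * (N - 1) / 2 * (r₁ * -θ₁ + σ₁ * (-θ₁) ^ 2) ≤ -(d * S ^ 2) by
        rw [neg_sq]; linarith)
    have h2 := Real.exp_le_exp.2 (show θ₂ * (r₂ * N - c * (R * S)) +
      (N : ℝ) * (r₂ * -θ₂ + σ₂ * (-θ₂) ^ 2) ≤ -(d * S ^ 2) by rw [neg_sq]; linarith)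
    linarith
end
end

section
/- Fix a real number a with 0 < a < 1. For each d > 0 there exist constants C₁, c₁ > 0 such that for every sequence (q_j)_{j≥0} of real numbers satisfying q_j ≥ q_{j+1} and 0 ≤ q_j ≤ 1 for all j, and every integer N ≥ 1: q_{⌈N**⌉} - C₁/N^d ≤ G(N) ≤ q_{⌊N*⌋} + C₁/N^d, where G(N) := (1-a)^N Σ_{j=0}^{∞} a^j C(N+j-1, j) q_j, N* := aN/(1-a) - c₁√(N log N) (with ⌊N*⌋ replaced by 0 if N* < 0), and N** := aN/(1-a) + c₁√(N log N). -/
noncomputable section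

/-- The generating function of the negative binomial weights. -/
theorem hasSum_negBinomial_s7 {r : ℝ} (hr : |r| < 1) {N : ℕ} (hN : 1 ≤ N) :
    HasSum (fun j : ℕ => r ^ j * (Nat.choose (N + j - 1) j : ℝ)) (1 / (1 - r) ^ N) := by
  obtain ⟨k, rfl⟩ : ∃ k, N = k + 1 := ⟨N - 1, by omega⟩
  have h := hasSum_choose_mul_geometric_of_norm_lt_one k (r := r) hr
  refine h.congr_fun fun j => ?_
  rw [show k + 1 + j - 1 = j + k by omega, Nat.choose_symm_add, mul_comm]

/-- A sub-Gaussian bound for one geometric factor of the negative binomial moment generating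
function. -/
theorem geometric_mgf_le_s7 {a s : ℝ} (ha : 0 < a) (ha1 : a < 1)
    (hs : |s| ≤ 1 / (1 + 4 * (a / (1 - a)))) :
    a * Real.exp s < 1 ∧ (1 - a) / (1 - a * Real.exp s) ≤
      Real.exp (a / (1 - a) * s + (a / (1 - a) + 8 * (a / (1 - a)) ^ 2) * s ^ 2) := by
  have h1a : 0 < 1 - a := by linarith
  set b := a / (1 - a) with hb
  have hb0 : 0 < b := by positivity
  have hs' : |s| * (1 + 4 * b) ≤ 1 := by rwa [le_div_iff₀ (by positivity)] at hs
  have hs1 : |s| ≤ 1 := by nlinarith [abs_nonneg s]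
  have hexp := abs_le.1 (Real.abs_exp_sub_one_sub_id_le hs1)
  have hexp' := Real.abs_exp_sub_one_le hs1
  set x := b * (Real.exp s - 1) with hx
  have hxabs : |x| ≤ 2 * b * |s| := by
    rw [hx, abs_mul, abs_of_pos hb0]
    nlinarith
  have hxhalf : |x| ≤ 1 / 2 := by nlinarith [abs_nonneg s]
  have hx1 : 0 < 1 - x := by linarith [le_abs_self x]
  have hfactor : 1 - a * Real.exp s = (1 - a) * (1 - x) := by
    rw [hx, hb]; field_simp; ring
  have hpos : 0 < 1 - a * Real.exp s := hfactor ▸ mul_pos h1a hx1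
  refine ⟨by linarith, ?_⟩
  have hlog := Real.abs_log_sub_add_sum_range_le (x := x) (by linarith) 1
  have hquad : |x| ^ (1 + 1) / (1 - |x|) ≤ 2 * x ^ 2 := by
    rw [div_le_iff₀ (by linarith), ← sq_abs x]
    calc |x| ^ (1 + 1) = 2 * |x| ^ 2 * (1 - 1 / 2) := by ring
      _ ≤ 2 * |x| ^ 2 * (1 - |x|) := by gcongr
  simp only [Finset.sum_range_one, zero_add, pow_one, Nat.cast_zero, div_one] at hlog
  have hlow := (abs_le.1 hlog).1
  have hxsq : x ^ 2 ≤ 4 * b ^ 2 * s ^ 2 := by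
    rw [← sq_abs x, ← sq_abs s]
    calc |x| ^ 2 ≤ (2 * b * |s|) ^ 2 := by gcongr
      _ = _ := by ring
  have hxle : x ≤ b * (s + s ^ 2) := mul_le_mul_of_nonneg_left (by linarith) hb0.le
  have hquot : (1 - a) / (1 - a * Real.exp s) = Real.exp (-Real.log (1 - x)) := by
    rw [Real.exp_neg, Real.exp_log hx1, hfactor]
    field_simp
  rw [hquot, Real.exp_le_exp]
  linarith

/-- The exponentially tilted negative binomial sum. -/
theorem hasSum_negBinomial_exp {a s : ℝ} (ha : 0 < a) (hs : a * Real.exp s < 1) {N : ℕ}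
    (hN : 1 ≤ N) (u : ℝ) :
    HasSum (fun j : ℕ => (1 - a) ^ N * (a ^ j * (Nat.choose (N + j - 1) j : ℝ)) *
        Real.exp (s * (j - u)))
      (((1 - a) / (1 - a * Real.exp s)) ^ N * Real.exp (-(s * u))) := by
  have habs : |a * Real.exp s| < 1 := by rwa [abs_of_pos (by positivity)]
  have hvalue : ((1 - a) / (1 - a * Real.exp s)) ^ N * Real.exp (-(s * u)) =
      (1 - a) ^ N * Real.exp (-(s * u)) * (1 / (1 - a * Real.exp s) ^ N) := by
    rw [div_pow]
    ring
  rw [hvalue]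
  refine ((hasSum_negBinomial_s7 habs hN).mul_left
    ((1 - a) ^ N * Real.exp (-(s * u)))).congr_fun fun j => ?_
  rw [mul_pow, ← Real.exp_nat_mul, show s * (j - u) = j * s + -(s * u) by ring, Real.exp_add]
  ring

/-- The Chernoff bound at deviation `t`, valid for tilts of either sign. -/
theorem negBinomial_chernoff {a s t : ℝ} (ha : 0 < a) (ha1 : a < 1)
    (hs : |s| ≤ 1 / (1 + 4 * (a / (1 - a)))) (N : ℕ) :
    ((1 - a) / (1 - a * Real.exp s)) ^ N * Real.exp (-(s * (a * N / (1 - a) + t))) ≤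
      Real.exp ((a / (1 - a) + 8 * (a / (1 - a)) ^ 2) * (N * s ^ 2) - s * t) := by
  obtain ⟨hlt, hle⟩ := geometric_mgf_le_s7 ha ha1 hs
  have hnonneg : 0 ≤ (1 - a) / (1 - a * Real.exp s) :=
    div_nonneg (by linarith) (by linarith)
  calc _ ≤ Real.exp (a / (1 - a) * s + (a / (1 - a) + 8 * (a / (1 - a)) ^ 2) * s ^ 2) ^ N *
        Real.exp (-(s * (a * N / (1 - a) + t))) := by gcongr
    _ = _ := by
      rw [← Real.exp_nat_mul, ← Real.exp_add]
      congr 1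
      ring

/-- De-Poissonization lemma for the negative binomial distribution:
for monotone `q_j ∈ [0,1]`, `q_{⌈N**⌉} - C₁/N^d ≤ G(N) ≤ q_{⌊N*⌋} + C₁/N^d`, where
`G(N) = (1-a)^N Σ_j a^j C(N+j-1,j) q_j`, `N* = aN/(1-a) - c₁√(N log N)` and
`N** = aN/(1-a) + c₁√(N log N)`. -/
theorem dePoissonization (a : ℝ) (ha : 0 < a) (ha1 : a < 1) (d : ℝ) (hd : 0 < d) :
    ∃ C₁ > (0 : ℝ), ∃ c₁ > (0 : ℝ), ∀ q : ℕ → ℝ,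
      (∀ j, q (j + 1) ≤ q j) → (∀ j, 0 ≤ q j ∧ q j ≤ 1) → ∀ N : ℕ, 1 ≤ N →
      q ⌈a * (N : ℝ) / (1 - a) + c₁ * Real.sqrt ((N : ℝ) * Real.log N)⌉₊ - C₁ / (N : ℝ) ^ d
          ≤ (1 - a) ^ N * ∑' j : ℕ, a ^ j * (Nat.choose (N + j - 1) j : ℝ) * q j ∧
        (1 - a) ^ N * ∑' j : ℕ, a ^ j * (Nat.choose (N + j - 1) j : ℝ) * q j
          ≤ q ⌊a * (N : ℝ) / (1 - a) - c₁ * Real.sqrt ((N : ℝ) * Real.log N)⌋₊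
            + C₁ / (N : ℝ) ^ d := by
  have h1a : 0 < 1 - a := by linarith
  set K := a / (1 - a) + 8 * (a / (1 - a)) ^ 2 with hK
  set σ := 1 / (1 + 4 * (a / (1 - a))) with hσ
  have hK0 : 0 < K := by positivity
  have hσ0 : 0 < σ := by positivity
  refine ⟨1, one_pos, (K * σ ^ 2 + d) / σ, by positivity, fun q hq hq01 N hN => ?_⟩
  have hanti : Antitone q := antitone_nat_of_succ_le hq
  have hN0 : (0 : ℝ) < N := by exact_mod_cast hN
  have hlog0 : 0 ≤ Real.log N := Real.log_natCast_nonneg N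
  set t := (K * σ ^ 2 + d) / σ * Real.sqrt (N * Real.log N) with ht
  set s := σ * Real.sqrt (Real.log N / N) with hs
  have hs0 : 0 ≤ s := by positivity
  have hsσ : s ≤ σ := by
    refine mul_le_of_le_one_right hσ0.le (Real.sqrt_le_one.2 ?_)
    rw [div_le_one hN0]
    exact (Real.log_le_sub_one_of_pos hN0).trans (by linarith)
  have hNs : N * s ^ 2 = σ ^ 2 * Real.log N := by
    rw [hs, mul_pow, Real.sq_sqrt (by positivity)]
    field_simp
  have hst : s * t = (K * σ ^ 2 + d) * Real.log N := by
    have hsqrt : Real.sqrt (Real.log N / N) * Real.sqrt (N * Real.log N) = Real.log N := by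
      rw [← Real.sqrt_mul (by positivity), show Real.log N / N * (N * Real.log N) =
        Real.log N ^ 2 by field_simp, Real.sqrt_sq hlog0]
    calc s * t = (K * σ ^ 2 + d) *
          (Real.sqrt (Real.log N / N) * Real.sqrt (N * Real.log N)) := by
            rw [hs, ht]; field_simp
      _ = _ := by rw [hsqrt]
  have hexp : Real.exp (K * (N * s ^ 2) - s * t) = 1 / (N : ℝ) ^ d := by
    rw [hNs, hst, Real.rpow_def_of_pos hN0, one_div, ← Real.exp_neg]
    congr 1
    ring
  have habs : |s| ≤ σ := by rwa [abs_of_nonneg hs0]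
  have habs' : |-s| ≤ σ := by rwa [abs_neg]
  have hup := negBinomial_chernoff (t := t) ha ha1 habs N
  have hdown := negBinomial_chernoff (t := -t) ha ha1 habs' N
  rw [← hK, hexp] at hup
  rw [← hK, neg_sq, neg_mul_neg, hexp, ← sub_eq_add_neg] at hdown
  have hsumup := hasSum_negBinomial_exp ha (geometric_mgf_le_s7 ha ha1 habs).1 hN
    (a * N / (1 - a) + t)
  have hsumdown := hasSum_negBinomial_exp ha (geometric_mgf_le_s7 ha ha1 habs').1 hN
    (a * N / (1 - a) - t)
  have hone : HasSum (fun j : ℕ => (1 - a) ^ N * (a ^ j * (Nat.choose (N + j - 1) j : ℝ))) 1 := by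
    have h := (hasSum_negBinomial_s7 (r := a) (by rwa [abs_of_pos ha]) hN).mul_left ((1 - a) ^ N)
    rwa [mul_one_div_cancel (pow_pos h1a N).ne'] at h
  set w : ℕ → ℝ := fun j => (1 - a) ^ N * (a ^ j * (Nat.choose (N + j - 1) j : ℝ)) with hw
  have hw0 : ∀ j, 0 ≤ w j := fun j => by positivity
  have hsummable : Summable fun j => w j * q j :=
    hone.summable.of_nonneg_of_le (fun j => mul_nonneg (hw0 j) (hq01 j).1)
      fun j => mul_le_of_le_one_right (hw0 j) (hq01 j).2
  have hG : (1 - a) ^ N * ∑' j : ℕ, a ^ j * (Nat.choose (N + j - 1) j : ℝ) * q j =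
      ∑' j, w j * q j := by
    rw [← tsum_mul_left]
    exact tsum_congr fun j => by simp only [hw]; ring
  rw [hG]
  constructor
  · set M := ⌈a * (N : ℝ) / (1 - a) + t⌉₊ with hM
    have hle := hasSum_le (fun j => ?_) ((hone.mul_right (q M)).sub hsumup) hsummable.hasSum
    · linarith
    change w j * q M - w j * _ ≤ w j * q j
    rw [← mul_sub]
    refine mul_le_mul_of_nonneg_left ?_ (hw0 j)
    rcases le_total j M with hj | hj
    · linarith [hanti hj, Real.exp_pos (s * (j - (a * N / (1 - a) + t)))]
    · have hj' : a * (N : ℝ) / (1 - a) + t ≤ j := Nat.ceil_le.1 hj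
      linarith [Real.one_le_exp (mul_nonneg hs0 (sub_nonneg.2 hj')), (hq01 j).1, (hq01 M).2]
  · set L := ⌊a * (N : ℝ) / (1 - a) - t⌋₊ with hL
    have hle := hasSum_le (fun j => ?_) hsummable.hasSum ((hone.mul_right (q L)).add hsumdown)
    · linarith
    change w j * q j ≤ w j * q L + w j * _
    rw [← mul_add]
    refine mul_le_mul_of_nonneg_left ?_ (hw0 j)
    rcases le_or_gt L j with hj | hj
    · linarith [hanti hj, Real.exp_pos (-s * (j - (a * N / (1 - a) - t)))]
    · have hj' : (j : ℝ) ≤ a * N / (1 - a) - t := (Nat.lt_of_lt_floor hj).le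
      linarith [Real.one_le_exp (mul_nonneg_of_nonpos_of_nonpos (neg_nonpos.2 hs0)
        (sub_nonpos.2 hj')), (hq01 j).2, (hq01 L).1]
end
end
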